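/- Let n ≥ 1 and let λ ∈ ℤⁿ with λ₁ ≥ … ≥ λₙ ≥ 0. Then in the type GL_n affine Hecke algebra H, 1₀ X^λ = Σ_{T ∈ B(λ)} X^T Ψ_T, where the sum is over all semistandard Young tableaux T of shape λ with entries in [n], 1₀ = Σ_{w ∈ S_n} T_w, and X^T = Π_{i=1}^n X_i^{c_i} with c_i the number of entries equal to i in T. -/

import Mathlib

set_option maxHeartbeats 1000000

attribute [local instance] Classical.propDecidable

noncomputable section

namespace HLHecke

/-- The base ring `ℤ[t^{±1}]` of Laurent polynomials. -/
abbrev HR : Type := LaurentPolynomial ℤ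

/-- The parameter `t`. -/
def tt : HR := LaurentPolynomial.T 1

/-! ### The symmetric group on `Fin n` -/

/-- The simple transposition `s_j = (j, j+1)` (junk value `1` if out of range). -/
def sgen (n : ℕ) (j : ℕ) : Equiv.Perm (Fin n) :=
  if h : j + 1 < n then Equiv.swap ⟨j, Nat.lt_of_succ_lt h⟩ ⟨j + 1, h⟩ else 1

/-- The product `s_{i₁} ⋯ s_{i_ℓ}` of a word `l = [i₁, …, i_ℓ]`. -/
def wordProd (n : ℕ) (l : List ℕ) : Equiv.Perm (Fin n) := (l.map (sgen n)).prod

/-- The action of `S_n` on `ℤⁿ` by permutation of coordinates. -/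
def wAct (n : ℕ) (w : Equiv.Perm (Fin n)) (μ : Fin n → ℤ) : Fin n → ℤ := fun i => μ (w⁻¹ i)

/-- The standard inner product on `ℤⁿ`. -/
def ip (n : ℕ) (μ ν : Fin n → ℤ) : ℤ := ∑ i, μ i * ν i

/-- The standard basis vector `ε_i`. -/
def eps (n : ℕ) (i : Fin n) : Fin n → ℤ := fun k => if k = i then 1 else 0

/-- The simple root `α_j = ε_j − ε_{j+1}` (0-indexed: entries `j` and `j+1` of `Fin n`). -/
def alpha (n : ℕ) (j : ℕ) : Fin n → ℤ :=
  fun i => if (i : ℕ) = j then 1 else if (i : ℕ) = j + 1 then -1 else 0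

/-- The fundamental weight `ϖ_k = ε₁ + … + ε_k`. -/
def varpi (n : ℕ) (k : ℕ) : Fin n → ℤ := fun i => if (i : ℕ) < k then 1 else 0

/-- The set of positive roots `R₊`. -/
def Rpos (n : ℕ) (β : Fin n → ℤ) : Prop := ∃ i j : Fin n, i < j ∧ β = eps n i - eps n j

/-- The Coxeter length: minimal length of a word in the simple transpositions. -/
def len (n : ℕ) (w : Equiv.Perm (Fin n)) : ℕ :=
  sInf {k | ∃ l : List ℕ, (∀ j ∈ l, j + 1 < n) ∧ l.length = k ∧ wordProd n l = w}

/-- A choice of reduced word for `w`. -/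
def redWord (n : ℕ) (w : Equiv.Perm (Fin n)) : List ℕ :=
  if h : ∃ l : List ℕ, (∀ j ∈ l, j + 1 < n) ∧ l.length = len n w ∧ wordProd n l = w
  then h.choose else []

/-! ### Columns -/

lemma col_card_le (n : ℕ) (C : Finset (Fin n)) : C.card ≤ n := by
  simpa using Finset.card_le_univ C

/-- The minimal length coset representative `u_C` attached to a column `C`:
it sends `1, …, ℓ` to the entries of `C` in increasing order and `ℓ+1, …, n` to the
entries of the complement of `C` in increasing order. -/
def colPerm (n : ℕ) (C : Finset (Fin n)) : Equiv.Perm (Fin n) :=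
  ((finCongr ((Nat.add_sub_cancel' (col_card_le n C)).symm)).trans
    finSumFinEquiv.symm).trans <|
  ((Equiv.sumCongr (C.orderIsoOfFin rfl).toEquiv
      ((Cᶜ.orderIsoOfFin (by simp [Finset.card_compl])).toEquiv)).trans <|
    (Equiv.sumCongr (Equiv.refl _) (Equiv.subtypeEquivRight (fun x => Finset.mem_compl))).trans
      (Equiv.sumCompl (fun x => x ∈ C)))

/-- The `k`-th smallest entry of a column (0-indexed, as a natural number; junk `0` if
out of range). -/
def nth (n : ℕ) (C : Finset (Fin n)) (k : ℕ) : ℕ := ((C.sort (· ≤ ·)).map Fin.val).getD k 0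

/-- The action of the simple transposition `s_j` on columns. -/
def sCol (n : ℕ) (j : ℕ) (C : Finset (Fin n)) : Finset (Fin n) := C.image (sgen n j)

/-- Semistandardness of the two-column filling `F ⊗ E` (`F` the left column):
entrywise `f_i ≤ e_i`. -/
def pairSS (n : ℕ) (F E : Finset (Fin n)) : Prop := ∀ k < E.card, nth n F k ≤ nth n E k

/-- A filling by columns (leftmost column first) is semistandard iff all adjacent pairs are. -/
def isSSYT (n : ℕ) (L : List (Finset (Fin n))) : Prop := L.Chain' (pairSS n)

/-- The set `B(ϖ_ℓ)` of columns of length `ℓ`. -/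
def colFinset (n : ℕ) (ℓ : ℕ) : Finset (Finset (Fin n)) := Finset.univ.filter fun C => C.card = ℓ

/-- The highest weight column `(1, …, k)`. -/
def hwCol (n : ℕ) (k : ℕ) : Finset (Fin n) := Finset.univ.filter fun x => (x : ℕ) < k

/-- The vector `⃗C ∈ ℤⁿ` attached to a column `C`. -/
def vecOf (n : ℕ) (C : Finset (Fin n)) : Fin n → ℤ := fun i => if i ∈ C then 1 else 0

/-- The sign `σ^j_C`: `-1` if `j ∈ C` and `j+1 ∉ C`, and `+1` otherwise. -/
def sigmaSign (n : ℕ) (j : ℕ) (C : Finset (Fin n)) : ℤ :=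
  if h : j + 1 < n then
    (if (⟨j, Nat.lt_of_succ_lt h⟩ : Fin n) ∈ C ∧ (⟨j + 1, h⟩ : Fin n) ∉ C then -1 else 1)
  else 1

/-! ### Shapes and tableaux -/

/-- The length `λ'_{j+1}` of the `(j+1)`-st column (0-indexed `j`) of the Young diagram
of a partition `λ`. -/
def shapeColLen (n : ℕ) (μ : Fin n → ℤ) (j : ℕ) : ℕ :=
  (Finset.univ.filter fun i : Fin n => (j : ℤ) < μ i).card

/-- The number of columns of the Young diagram of a dominant weight. -/
def numCols (n : ℕ) (μ : Fin n → ℤ) : ℕ := Finset.univ.sup fun i : Fin n => (μ i).toNat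

/-- The highest weight tableau `T⁰_μ`: row `i` is filled with `i`, i.e. its columns are the
highest weight columns. -/
def hwTableau (n : ℕ) (μ : Fin n → ℤ) : List (Finset (Fin n)) :=
  List.ofFn fun j : Fin (numCols n μ) => hwCol n (shapeColLen n μ (j : ℕ))

/-- The content vector of a tableau: `(wtVec T) i` is the number of entries equal to `i`. -/
def wtVec (n : ℕ) (L : List (Finset (Fin n))) : Fin n → ℤ :=
  fun i => ((L.filter fun C => i ∈ C).length : ℤ)

/-! ### Macdonald's ψ statistic -/

/-- Number of entries `≤ i` in the column at position `p` (0-indexed from the left). -/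
def colCount (n : ℕ) (L : List (Finset (Fin n))) (i p : ℕ) : ℕ :=
  ((L.getD p ∅).filter fun x => (x : ℕ) < i).card

/-- The factor `ψ_{T_{≤ i+1}/T_{≤ i}}` of Macdonald's ψ. -/
def stripFactor (n : ℕ) (L : List (Finset (Fin n))) (i : ℕ) : HR :=
  ∏ p ∈ Finset.range L.length,
    if colCount n L (i + 1) p = colCount n L i p ∧
        colCount n L (i + 1) (p + 1) = colCount n L i (p + 1) + 1 then
      1 - tt ^ (colCount n L i p - colCount n L i (p + 1))
    else 1

/-- Macdonald's `ψ_T = ∏_{i=1}^{n-1} ψ_{T_{≤ i+1}/T_{≤ i}}` for a semistandard tableau. -/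
def macPsi (n : ℕ) (L : List (Finset (Fin n))) : HR := ∏ i ∈ Finset.Ico 1 n, stripFactor n L i

/-- Macdonald's tableau statistic, extended by `0` to non-semistandard fillings. -/
def psiT (n : ℕ) (L : List (Finset (Fin n))) : HR := if isSSYT n L then macPsi n L else 0

/-! ### The affine Hecke algebra -/

/-- Generators of the affine Hecke algebra. -/
inductive AGen (n : ℕ) : Type
  | T : ℕ → AGen n
  | X : Fin n → AGen n
  | Xinv : Fin n → AGen n

/-- The free algebra on the generators. -/
abbrev FA (n : ℕ) := FreeAlgebra HR (AGen n)

def fT (n : ℕ) (j : ℕ) : FA n := FreeAlgebra.ι HR (AGen.T j)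
def fX (n : ℕ) (i : Fin n) : FA n := FreeAlgebra.ι HR (AGen.X i)
def fXi (n : ℕ) (i : Fin n) : FA n := FreeAlgebra.ι HR (AGen.Xinv i)

/-- The defining relations of the type `GL_n` affine Hecke algebra. -/
inductive ARel (n : ℕ) : FA n → FA n → Prop
  | junk (j : ℕ) (h : ¬ j + 1 < n) : ARel n (fT n j) 1
  | quad (j : ℕ) (h : j + 1 < n) :
      ARel n (fT n j * fT n j) ((tt - 1) • fT n j + algebraMap HR (FA n) tt)
  | braid (j : ℕ) (h : j + 2 < n) :
      ARel n (fT n j * fT n (j + 1) * fT n j) (fT n (j + 1) * fT n j * fT n (j + 1))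
  | commT (j k : ℕ) (hjk : j + 1 < k) (hk : k + 1 < n) :
      ARel n (fT n j * fT n k) (fT n k * fT n j)
  | commX (i i' : Fin n) : ARel n (fX n i * fX n i') (fX n i' * fX n i)
  | XinvL (i : Fin n) : ARel n (fX n i * fXi n i) 1
  | XinvR (i : Fin n) : ARel n (fXi n i * fX n i) 1
  | TXT (j : ℕ) (h : j + 1 < n) :
      ARel n (fT n j * fX n ⟨j, Nat.lt_of_succ_lt h⟩ * fT n j) (tt • fX n ⟨j + 1, h⟩)
  | TXcomm (j : ℕ) (h : j + 1 < n) (i : Fin n) (hi1 : (i : ℕ) ≠ j) (hi2 : (i : ℕ) ≠ j + 1) :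
      ARel n (fT n j * fX n i) (fX n i * fT n j)

/-- The type `GL_n` affine Hecke algebra. -/
abbrev H (n : ℕ) := RingQuot (ARel n)

/-- The generator `T_j` of the (affine) Hecke algebra. -/
def Tg (n : ℕ) (j : ℕ) : H n := RingQuot.mkAlgHom HR (ARel n) (fT n j)

/-- The generator `X_i`. -/
def Xg (n : ℕ) (i : Fin n) : H n := RingQuot.mkAlgHom HR (ARel n) (fX n i)

/-- The generator `X_i⁻¹`. -/
def Xig (n : ℕ) (i : Fin n) : H n := RingQuot.mkAlgHom HR (ARel n) (fXi n i)

/-- The scalar `t` inside `H`. -/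
def tH (n : ℕ) : H n := algebraMap HR (H n) tt

/-- The scalar `t^k` inside `H`. -/
def tpow (n : ℕ) (k : ℕ) : H n := algebraMap HR (H n) (tt ^ k)

/-- The monomial `X^μ` for `μ ∈ ℤⁿ`. -/
def Xmon (n : ℕ) (μ : Fin n → ℤ) : H n :=
  (List.ofFn fun i : Fin n =>
    if 0 ≤ μ i then Xg n i ^ (μ i).toNat else Xig n i ^ (-μ i).toNat).prod

/-- The product `T_{i₁} ⋯ T_{i_ℓ}` of a word. -/
def TofWord (n : ℕ) (l : List ℕ) : H n := (l.map (Tg n)).prod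

/-- The element `T_w`, defined via a choice of reduced word for `w`. -/
def Tw (n : ℕ) (w : Equiv.Perm (Fin n)) : H n := TofWord n (redWord n w)

/-- The finite Hecke symmetrizer `1₀ = Σ_{w ∈ S_n} T_w`. -/
def one0 (n : ℕ) : H n := ∑ w : Equiv.Perm (Fin n), Tw n w

/-- The stabilizer `S_{n,λ}` as a finset. -/
def stabFinset (n : ℕ) (lam : Fin n → ℤ) : Finset (Equiv.Perm (Fin n)) :=
  Finset.univ.filter fun w => wAct n w lam = lam

/-- The parabolic symmetrizer `1_λ = Σ_{w ∈ S_{n,λ}} T_w`. -/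
def onePara (n : ℕ) (lam : Fin n → ℤ) : H n := ∑ w ∈ stabFinset n lam, Tw n w

/-- The Poincaré polynomial `W_λ(t) = Σ_{w ∈ S_{n,λ}} t^{ℓ(w)}`. -/
def Wlam (n : ℕ) (lam : Fin n → ℤ) : HR := ∑ w ∈ stabFinset n lam, tt ^ len n w

/-- The parabolic subalgebra `H_{n,λ}`, as the span of `{T_w : w ∈ S_{n,λ}}`. -/
def HparaM (n : ℕ) (lam : Fin n → ℤ) : Submodule HR (H n) :=
  Submodule.span HR (Tw n '' {w | wAct n w lam = lam})

/-- The finite Hecke algebra `H_n`, the subalgebra generated by the `T_j`. -/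
def Hfin (n : ℕ) : Subalgebra HR (H n) := Algebra.adjoin HR (Set.range (Tg n))

/-- The coefficient `h_{C, S}` of the parabolic decomposition
`h = Σ_{F ∈ B(ϖ_ℓ)} T_{u_F} h_F` (defined via choice; it is unique). -/
def paraCoeff (n : ℕ) (ℓ : ℕ) (h : H n) (C : Finset (Fin n)) : H n :=
  if hex : ∃ g : Finset (Fin n) → H n,
      (∀ F : Finset (Fin n), F.card = ℓ → g F ∈ HparaM n (varpi n ℓ)) ∧
      h = ∑ F ∈ colFinset n ℓ, Tw n (colPerm n F) * g F
  then hex.choose C else 0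

/-- The elements `Ψ_T` of the finite Hecke algebra, defined by recursion on the columns of `T`
(leftmost column first).  By convention `Ψ` of the empty tableau is `1₀`. -/
def Psi (n : ℕ) : List (Finset (Fin n)) → H n
  | [] => one0 n
  | [C] => tpow n (len n (colPerm n C)) * Ring.inverse (Tw n (colPerm n C)⁻¹) *
      onePara n (varpi n C.card)
  | C :: S => tpow n (len n (colPerm n C)) * Ring.inverse (Tw n (colPerm n C)⁻¹) *
      paraCoeff n C.card (Psi n S) C

end HLHecke
namespace HLHecke

lemma sgen_val (n j : ℕ) (h : j + 1 < n) (x : Fin n) :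
    (sgen n j x : ℕ) = if (x : ℕ) = j then j + 1 else if (x : ℕ) = j + 1 then j else x := by
  unfold sgen
  rw [dif_pos h, Equiv.swap_apply_def]
  simp only [Fin.ext_iff]
  split_ifs <;> rfl

lemma sgen_mul_self (n j : ℕ) : sgen n j * sgen n j = 1 := by
  unfold sgen
  split_ifs <;> simp

lemma sgen_inv (n j : ℕ) : (sgen n j)⁻¹ = sgen n j :=
  inv_eq_of_mul_eq_one_left (sgen_mul_self n j)

lemma sgen_sgen (n j : ℕ) (x : Fin n) : sgen n j (sgen n j x) = x := by
  rw [← Equiv.Perm.mul_apply, sgen_mul_self, Equiv.Perm.one_apply]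

lemma sgen_cancel (n j : ℕ) (w : Equiv.Perm (Fin n)) : sgen n j * (sgen n j * w) = w := by
  rw [← mul_assoc, sgen_mul_self, one_mul]

lemma sgen_cancel_right (n j : ℕ) (w : Equiv.Perm (Fin n)) : w * sgen n j * sgen n j = w := by
  rw [mul_assoc, sgen_mul_self, mul_one]

lemma sgen_lo (n j : ℕ) (h : j + 1 < n) :
    sgen n j ⟨j, Nat.lt_of_succ_lt h⟩ = ⟨j + 1, h⟩ := by
  apply Fin.ext; rw [sgen_val n j h]; simp

lemma sgen_hi (n j : ℕ) (h : j + 1 < n) :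
    sgen n j ⟨j + 1, h⟩ = ⟨j, Nat.lt_of_succ_lt h⟩ := by
  apply Fin.ext; rw [sgen_val n j h]; simp

lemma sgen_other (n j : ℕ) (h : j + 1 < n) (x : Fin n) (h1 : (x : ℕ) ≠ j) (h2 : (x : ℕ) ≠ j + 1) :
    sgen n j x = x := by
  apply Fin.ext; rw [sgen_val n j h]; simp [h1, h2]

lemma sgen_lt (n j : ℕ) (h : j + 1 < n) (a b : Fin n) (hab : a < b)
    (hne : ¬ ((a : ℕ) = j ∧ (b : ℕ) = j + 1)) : sgen n j a < sgen n j b := by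
  rw [Fin.lt_def] at *
  rw [sgen_val n j h, sgen_val n j h]
  split_ifs <;> omega

lemma sgen_comm (n i j : ℕ) (hij : i + 1 < j) (hj : j + 1 < n) :
    sgen n i * sgen n j = sgen n j * sgen n i := by
  ext x
  simp only [Equiv.Perm.mul_apply]
  rw [sgen_val n i (by omega), sgen_val n j hj, sgen_val n j hj, sgen_val n i (by omega)]
  split_ifs <;> omega

lemma sgen_braid (n j : ℕ) (hj : j + 2 < n) :
    sgen n j * sgen n (j+1) * sgen n j = sgen n (j+1) * sgen n j * sgen n (j+1) := by
  ext x
  simp only [Equiv.Perm.mul_apply]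
  rw [sgen_val n j (by omega), sgen_val n (j+1) hj, sgen_val n j (by omega),
    sgen_val n (j+1) hj, sgen_val n j (by omega), sgen_val n (j+1) hj]
  split_ifs <;> omega

/-- inversion set -/
def invSet (n : ℕ) (w : Equiv.Perm (Fin n)) : Finset (Fin n × Fin n) :=
  Finset.univ.filter fun p => p.1 < p.2 ∧ w p.2 < w p.1

def inv (n : ℕ) (w : Equiv.Perm (Fin n)) : ℕ := (invSet n w).card

lemma mem_invSet (n : ℕ) (w : Equiv.Perm (Fin n)) (a b : Fin n) :
    (a, b) ∈ invSet n w ↔ a < b ∧ w b < w a := by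
  simp [invSet]

lemma inv_one (n : ℕ) : inv n 1 = 0 := by
  unfold inv invSet
  rw [Finset.card_eq_zero, Finset.filter_eq_empty_iff]
  rintro p - ⟨h1, h2⟩
  exact absurd h1 (not_lt.mpr h2.le)

lemma inv_inv (n : ℕ) (w : Equiv.Perm (Fin n)) : inv n w⁻¹ = inv n w := by
  unfold inv invSet
  symm
  apply Finset.card_bij (fun p _ => (w p.2, w p.1))
  · rintro p hp
    simp only [Finset.mem_filter, Finset.mem_univ, true_and] at hp ⊢
    simpa using hp.symm
  · rintro ⟨a, b⟩ - ⟨c, d⟩ - h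
    simp at h
    simp [h]
  · rintro ⟨a, b⟩ hp
    simp only [Finset.mem_filter, Finset.mem_univ, true_and] at hp
    exact ⟨(w⁻¹ b, w⁻¹ a), by simpa using hp.symm, by simp⟩

/-- right ascent raises inv -/
lemma inv_mul_sgen (n j : ℕ) (h : j + 1 < n) (w : Equiv.Perm (Fin n))
    (hw : w ⟨j, Nat.lt_of_succ_lt h⟩ < w ⟨j + 1, h⟩) :
    inv n (w * sgen n j) = inv n w + 1 := by
  unfold inv
  have key : invSet n (w * sgen n j) = insert (⟨j, Nat.lt_of_succ_lt h⟩, ⟨j + 1, h⟩)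
      ((invSet n w).image fun p => (sgen n j p.1, sgen n j p.2)) := by
    ext ⟨a, b⟩
    simp only [mem_invSet, Finset.mem_insert, Finset.mem_image, Equiv.Perm.mul_apply, Prod.mk.injEq, Prod.exists]
    constructor
    · rintro ⟨h1, h2⟩
      by_cases hne : (a : ℕ) = j ∧ (b : ℕ) = j + 1
      · left; exact ⟨Fin.ext hne.1, Fin.ext hne.2⟩
      · right
        exact ⟨sgen n j a, sgen n j b, ⟨sgen_lt n j h a b h1 hne, h2⟩, sgen_sgen _ _ _, sgen_sgen _ _ _⟩
    · rintro (⟨rfl, rfl⟩ | ⟨c, d, ⟨h1, h2⟩, rfl, rfl⟩)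
      · rw [sgen_lo n j h, sgen_hi n j h]
        exact ⟨by simp, hw⟩
      · rw [sgen_sgen, sgen_sgen]
        refine ⟨sgen_lt n j h c d h1 ?_, h2⟩
        rintro ⟨hc, hd⟩
        have e1 : c = ⟨j, Nat.lt_of_succ_lt h⟩ := Fin.ext hc
        have e2 : d = ⟨j+1, h⟩ := Fin.ext hd
        rw [e1, e2] at h2
        exact absurd hw (not_lt.mpr h2.le)
  rw [key, Finset.card_insert_of_notMem, Finset.card_image_of_injective]
  · rintro ⟨a, b⟩ ⟨c, d⟩ hh
    simp at hh
    simp [hh]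
  · simp only [mem_invSet, Finset.mem_image, Prod.mk.injEq, Prod.exists, not_exists]
    rintro a b ⟨⟨h1, h2⟩, h3, h4⟩
    have e1 : a = ⟨j+1, h⟩ := by rw [← sgen_sgen n j a, h3, sgen_lo n j h]
    have e2 : b = ⟨j, Nat.lt_of_succ_lt h⟩ := by rw [← sgen_sgen n j b, h4, sgen_hi n j h]
    rw [e1, e2, Fin.lt_def] at h1
    simp at h1

/-- left ascent -/
def LA (n : ℕ) (w : Equiv.Perm (Fin n)) (j : ℕ) (h : j + 1 < n) : Prop :=
  w⁻¹ ⟨j, Nat.lt_of_succ_lt h⟩ < w⁻¹ ⟨j + 1, h⟩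

lemma LA_sgen (n j : ℕ) (h : j + 1 < n) (w : Equiv.Perm (Fin n)) :
    LA n (sgen n j * w) j h ↔ ¬ LA n w j h := by
  unfold LA
  rw [mul_inv_rev, sgen_inv, Equiv.Perm.mul_apply, Equiv.Perm.mul_apply, sgen_lo n j h,
    sgen_hi n j h, not_lt]
  constructor
  · exact le_of_lt
  · intro hle
    refine lt_of_le_of_ne hle ?_
    intro he
    have := w⁻¹.injective he
    simp at this

lemma inv_up (n j : ℕ) (h : j + 1 < n) (w : Equiv.Perm (Fin n)) (hw : LA n w j h) :
    inv n (sgen n j * w) = inv n w + 1 := by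
  have := inv_mul_sgen n j h w⁻¹ hw
  rw [inv_inv] at this
  rw [← this, ← inv_inv, mul_inv_rev, sgen_inv]

lemma inv_down (n j : ℕ) (h : j + 1 < n) (w : Equiv.Perm (Fin n)) (hw : ¬ LA n w j h) :
    inv n w = inv n (sgen n j * w) + 1 := by
  have := inv_up n j h (sgen n j * w) ((LA_sgen n j h w).2 hw)
  rwa [sgen_cancel] at this

lemma exists_descent (n : ℕ) (w : Equiv.Perm (Fin n)) (hw : w ≠ 1) :
    ∃ j, ∃ h : j + 1 < n, ¬ LA n w j h := by
  by_contra hcon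
  push Not at hcon
  apply hw
  have hmono : StrictMono (w⁻¹ : Equiv.Perm (Fin n)) := by
    cases n with
    | zero => intro a; exact a.elim0
    | succ m =>
      rw [Fin.strictMono_iff_lt_succ]
      intro i
      have := hcon i (by omega)
      exact this
  have h2 : ∀ x, w⁻¹ x = x := by
    intro x
    let e : Fin n ≃o Fin n := StrictMono.orderIsoOfSurjective _ hmono w⁻¹.surjective
    have : e = OrderIso.refl _ := Subsingleton.elim _ _
    have h3 : e x = x := by rw [this]; rfl
    exact h3
  have : w⁻¹ = 1 := Equiv.ext h2
  exact inv_eq_one.mp this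

lemma wordProd_cons (n i : ℕ) (l : List ℕ) :
    wordProd n (i :: l) = sgen n i * wordProd n l := by simp [wordProd]

lemma wordProd_nil (n : ℕ) : wordProd n [] = 1 := by simp [wordProd]

lemma inv_le_length (n : ℕ) (l : List ℕ) (hl : ∀ j ∈ l, j + 1 < n) :
    inv n (wordProd n l) ≤ l.length := by
  induction l with
  | nil => simp [wordProd_nil, inv_one]
  | cons i l ih =>
    have h := hl i (by simp)
    have ih := ih (fun j hj => hl j (by simp [hj]))
    rw [wordProd_cons, List.length_cons]
    by_cases hd : LA n (wordProd n l) i h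
    · rw [inv_up n i h _ hd]; omega
    · have := inv_down n i h _ hd; omega

lemma exists_word (n : ℕ) (k : ℕ) : ∀ w : Equiv.Perm (Fin n), inv n w = k →
    ∃ l : List ℕ, (∀ j ∈ l, j + 1 < n) ∧ l.length = k ∧ wordProd n l = w := by
  induction k with
  | zero =>
    intro w hw
    by_cases h1 : w = 1
    · exact ⟨[], by simp, rfl, by rw [h1, wordProd_nil]⟩
    · obtain ⟨j, h, hd⟩ := exists_descent n w h1
      have := inv_down n j h w hd
      omega
  | succ k ih =>
    intro w hw
    have h1 : w ≠ 1 := by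
      rintro rfl
      rw [inv_one] at hw; omega
    obtain ⟨j, h, hd⟩ := exists_descent n w h1
    have := inv_down n j h w hd
    obtain ⟨l, hl1, hl2, hl3⟩ := ih (sgen n j * w) (by omega)
    refine ⟨j :: l, ?_, by simp [hl2], by rw [wordProd_cons, hl3, sgen_cancel]⟩
    intro i hi
    rcases List.mem_cons.1 hi with rfl | hi
    · exact h
    · exact hl1 i hi

lemma len_eq (n : ℕ) (w : Equiv.Perm (Fin n)) : len n w = inv n w := by
  unfold len
  apply le_antisymm
  · exact Nat.sInf_le (exists_word n _ w rfl)
  · have hne : {k | ∃ l : List ℕ, (∀ j ∈ l, j + 1 < n) ∧ l.length = k ∧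
        wordProd n l = w}.Nonempty := ⟨_, exists_word n _ w rfl⟩
    obtain ⟨l, h1, h2, h3⟩ := Nat.sInf_mem hne
    rw [← h2]
    conv_lhs => rw [← h3]
    exact inv_le_length n l h1

/-- reduced word -/
def Red (n : ℕ) (l : List ℕ) (w : Equiv.Perm (Fin n)) : Prop :=
  (∀ j ∈ l, j + 1 < n) ∧ l.length = inv n w ∧ wordProd n l = w

lemma redWord_red (n : ℕ) (w : Equiv.Perm (Fin n)) : Red n (redWord n w) w := by
  have h : ∃ l : List ℕ, (∀ j ∈ l, j + 1 < n) ∧ l.length = len n w ∧ wordProd n l = w := by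
    rw [len_eq]; exact exists_word n _ w rfl
  unfold redWord
  rw [dif_pos h]
  have := h.choose_spec
  exact ⟨this.1, by rw [this.2.1, len_eq], this.2.2⟩

lemma Red.tail {n i : ℕ} {l : List ℕ} {w : Equiv.Perm (Fin n)} (hr : Red n (i :: l) w) :
    ∃ h : i + 1 < n, ¬ LA n w i h ∧ Red n l (sgen n i * w) := by
  obtain ⟨h1, h2, h3⟩ := hr
  have h := h1 i (by simp)
  have hl : ∀ j ∈ l, j + 1 < n := fun j hj => h1 j (by simp [hj])
  rw [wordProd_cons] at h3
  have h4 : wordProd n l = sgen n i * w := by rw [← h3, sgen_cancel]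
  have h5 := inv_le_length n l hl
  rw [h4] at h5
  rw [List.length_cons] at h2
  have h6 : ¬ LA n w i h := by
    intro hla
    have := inv_up n i h w hla
    omega
  have := inv_down n i h w h6
  exact ⟨h, h6, hl, by omega, h4⟩

lemma Red.cons {n i : ℕ} {l : List ℕ} {w : Equiv.Perm (Fin n)} (h : i + 1 < n)
    (hd : ¬ LA n w i h) (hr : Red n l (sgen n i * w)) : Red n (i :: l) w := by
  obtain ⟨h1, h2, h3⟩ := hr
  refine ⟨?_, ?_, ?_⟩
  · intro j hj
    rcases List.mem_cons.1 hj with rfl | hj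
    · exact h
    · exact h1 j hj
  · have := inv_down n i h w hd
    rw [List.length_cons]; omega
  · rw [wordProd_cons, h3, sgen_cancel]
lemma Tg_junk (n j : ℕ) (h : ¬ j + 1 < n) : Tg n j = 1 := by
  have := RingQuot.mkAlgHom_rel HR (ARel.junk (n := n) j h)
  rw [map_one] at this
  exact this

lemma Tg_quad (n j : ℕ) (h : j + 1 < n) :
    Tg n j * Tg n j = (tt - 1) • Tg n j + algebraMap HR (H n) tt := by
  have := RingQuot.mkAlgHom_rel HR (ARel.quad (n := n) j h)
  rw [map_mul, map_add, map_smul, AlgHom.commutes] at this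
  exact this

lemma Tg_braid (n j : ℕ) (h : j + 2 < n) :
    Tg n j * Tg n (j+1) * Tg n j = Tg n (j+1) * Tg n j * Tg n (j+1) := by
  have := RingQuot.mkAlgHom_rel HR (ARel.braid (n := n) j h)
  simp only [map_mul] at this
  exact this

lemma Tg_comm (n j k : ℕ) (hjk : j + 1 < k) (hk : k + 1 < n) :
    Tg n j * Tg n k = Tg n k * Tg n j := by
  have := RingQuot.mkAlgHom_rel HR (ARel.commT (n := n) j k hjk hk)
  simp only [map_mul] at this
  exact this

lemma Xg_comm (n : ℕ) (i i' : Fin n) : Xg n i * Xg n i' = Xg n i' * Xg n i := by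
  have := RingQuot.mkAlgHom_rel HR (ARel.commX (n := n) i i')
  simp only [map_mul] at this
  exact this

lemma TXT (n j : ℕ) (h : j + 1 < n) :
    Tg n j * Xg n ⟨j, Nat.lt_of_succ_lt h⟩ * Tg n j = tt • Xg n ⟨j + 1, h⟩ := by
  have := RingQuot.mkAlgHom_rel HR (ARel.TXT (n := n) j h)
  simp only [map_mul, map_smul] at this
  exact this

lemma TXcomm (n j : ℕ) (h : j + 1 < n) (i : Fin n) (hi1 : (i : ℕ) ≠ j) (hi2 : (i : ℕ) ≠ j + 1) :
    Tg n j * Xg n i = Xg n i * Tg n j := by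
  have := RingQuot.mkAlgHom_rel HR (ARel.TXcomm (n := n) j h i hi1 hi2)
  simp only [map_mul] at this
  exact this

lemma TofWord_cons (n i : ℕ) (l : List ℕ) :
    TofWord n (i :: l) = Tg n i * TofWord n l := by simp [TofWord]

lemma Red.ex (n : ℕ) (w : Equiv.Perm (Fin n)) : ∃ l, Red n l w := ⟨_, redWord_red n w⟩

lemma matsumoto_step (n : ℕ) (k : ℕ)
    (ih : ∀ m < k, ∀ (w : Equiv.Perm (Fin n)) (l l' : List ℕ), l.length = m → Red n l w →
      Red n l' w → TofWord n l = TofWord n l')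
    (w : Equiv.Perm (Fin n)) (i j : ℕ) (hij : i < j) (a b : List ℕ) (hk : (i :: a).length = k)
    (ha : Red n (i :: a) w) (hb : Red n (j :: b) w) :
    TofWord n (i :: a) = TofWord n (j :: b) := by
  obtain ⟨hi, di, ra⟩ := ha.tail
  obtain ⟨hj, dj, rb⟩ := hb.tail
  have hab : a.length = b.length := by
    have h1 := ha.2.1
    have h2 := hb.2.1
    simp only [List.length_cons] at h1 h2
    omega
  have hla : a.length < k := by simp only [List.length_cons] at hk; omega
  rw [TofWord_cons, TofWord_cons]
  by_cases hc : i + 1 < j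
  · have hcm := sgen_comm n i j hc hj
    obtain ⟨c, rc⟩ := Red.ex n (sgen n j * (sgen n i * w))
    have r1 : Red n (j :: c) (sgen n i * w) := by
      refine Red.cons hj ?_ rc
      unfold LA at dj ⊢
      rw [mul_inv_rev, sgen_inv, Equiv.Perm.mul_apply, Equiv.Perm.mul_apply,
        sgen_other n i hi _ (by simp; omega) (by simp; omega),
        sgen_other n i hi _ (by simp; omega) (by simp; omega)]
      exact dj
    have r2 : Red n (i :: c) (sgen n j * w) := by
      refine Red.cons hi ?_ ?_
      · unfold LA at di ⊢
        rw [mul_inv_rev, sgen_inv, Equiv.Perm.mul_apply, Equiv.Perm.mul_apply,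
          sgen_other n j hj _ (by simp; omega) (by simp; omega),
          sgen_other n j hj _ (by simp; omega) (by simp; omega)]
        exact di
      · rw [← mul_assoc, hcm, mul_assoc]; exact rc
    rw [ih _ hla _ a (j :: c) rfl ra r1, ih _ (hab ▸ hla) _ b (i :: c) rfl rb r2,
      TofWord_cons, TofWord_cons, ← mul_assoc, ← mul_assoc, Tg_comm n i j hc hj]
  · obtain rfl : j = i + 1 := by omega
    have hbr := sgen_braid n i (by omega)
    obtain ⟨c, rc⟩ := Red.ex n (sgen n i * (sgen n (i+1) * (sgen n i * w)))
    unfold LA at di dj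
    rw [not_lt] at di dj
    have hne1 : w⁻¹ ⟨i + 1, hi⟩ ≠ w⁻¹ ⟨i, by omega⟩ := by
      intro he; have := w⁻¹.injective he; simp at this
    have hne2 : w⁻¹ ⟨i + 1 + 1, hj⟩ ≠ w⁻¹ ⟨i + 1, hi⟩ := by
      intro he; have := w⁻¹.injective he; simp at this
    have l1 := lt_of_le_of_ne di hne1
    have l2 := lt_of_le_of_ne dj hne2
    have o1 : sgen n i ⟨i + 1 + 1, hj⟩ = ⟨i + 1 + 1, hj⟩ :=
      sgen_other n i hi _ (by simp; omega) (by simp)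
    have o2 : sgen n (i+1) ⟨i, by omega⟩ = ⟨i, by omega⟩ :=
      sgen_other n (i+1) hj _ (by simp) (by simp; omega)
    have o3 := sgen_lo n i hi
    have o4 := sgen_hi n i hi
    have o5 := sgen_lo n (i+1) hj
    have o6 := sgen_hi n (i+1) hj
    have r1 : Red n ((i+1) :: i :: c) (sgen n i * w) := by
      refine Red.cons hj ?_ (Red.cons hi ?_ rc)
      · unfold LA
        simp only [mul_inv_rev, sgen_inv, Equiv.Perm.mul_apply, o1, o4, not_lt]
        exact (l2.trans l1).le
      · unfold LA
        simp only [mul_inv_rev, sgen_inv, Equiv.Perm.mul_apply, o1, o2, o3, o5, not_lt]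
        exact l2.le
    have r2 : Red n (i :: (i+1) :: c) (sgen n (i+1) * w) := by
      refine Red.cons hi ?_ (Red.cons hj ?_ ?_)
      · unfold LA
        simp only [mul_inv_rev, sgen_inv, Equiv.Perm.mul_apply, o2, o5, not_lt]
        exact (l2.trans l1).le
      · unfold LA
        simp only [mul_inv_rev, sgen_inv, Equiv.Perm.mul_apply, o1, o2, o4, o6, not_lt]
        exact l1.le
      · have : sgen n (i + 1) * (sgen n i * (sgen n (i + 1) * w)) =
            sgen n i * (sgen n (i+1) * (sgen n i * w)) := by
          simp only [← mul_assoc]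
          rw [hbr]
        rw [this]; exact rc
    rw [ih _ hla _ a _ rfl ra r1, ih _ (hab ▸ hla) _ b _ rfl rb r2]
    simp only [TofWord_cons, ← mul_assoc]
    rw [Tg_braid n i (by omega)]

lemma matsumoto (n : ℕ) (k : ℕ) : ∀ (w : Equiv.Perm (Fin n)) (l l' : List ℕ), l.length = k →
    Red n l w → Red n l' w → TofWord n l = TofWord n l' := by
  induction k using Nat.strong_induction_on with
  | _ k ih =>
    intro w l l' hk hl hl'
    have hlen : l.length = l'.length := by rw [hl.2.1, hl'.2.1]
    match l, l' with
    | [], [] => rfl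
    | [], _ :: _ => simp at hlen
    | _ :: _, [] => simp at hlen
    | i :: a, j :: b =>
      rcases lt_trichotomy i j with hij | rfl | hij
      · exact matsumoto_step n k ih w i j hij a b hk hl hl'
      · obtain ⟨hi, di, ra⟩ := hl.tail
        obtain ⟨hj, dj, rb⟩ := hl'.tail
        rw [TofWord_cons, TofWord_cons, ih a.length (by simp at hk; omega) _ a b rfl ra rb]
      · exact (matsumoto_step n k ih w j i hij b a (by rw [← hlen]; exact hk) hl' hl).symm

lemma TofWord_eq {n : ℕ} {l : List ℕ} {w : Equiv.Perm (Fin n)} (h : Red n l w) :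
    TofWord n l = Tw n w := matsumoto n _ w l _ rfl h (redWord_red n w)

lemma Tw_one (n : ℕ) : Tw n 1 = 1 := by
  rw [← TofWord_eq (l := []) ⟨by simp, by simp [inv_one], wordProd_nil n⟩]
  simp [TofWord]

lemma Tw_left (n j : ℕ) (h : j + 1 < n) (w : Equiv.Perm (Fin n)) (hw : LA n w j h) :
    Tw n (sgen n j * w) = Tg n j * Tw n w := by
  have : Red n (j :: redWord n w) (sgen n j * w) := by
    refine Red.cons h ?_ ?_
    · rw [LA_sgen]; simpa using hw
    · rw [sgen_cancel]; exact redWord_red n w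
  rw [← TofWord_eq this, TofWord_cons]; rfl

lemma Tw_right (n j : ℕ) (h : j + 1 < n) (w : Equiv.Perm (Fin n))
    (hw : w ⟨j, Nat.lt_of_succ_lt h⟩ < w ⟨j + 1, h⟩) :
    Tw n (w * sgen n j) = Tw n w * Tg n j := by
  have hr := redWord_red n w
  have : Red n (redWord n w ++ [j]) (w * sgen n j) := by
    refine ⟨?_, ?_, ?_⟩
    · intro i hi
      rcases List.mem_append.1 hi with hi | hi
      · exact hr.1 i hi
      · rw [List.mem_singleton.1 hi]; exact h
    · rw [List.length_append, hr.2.1, inv_mul_sgen n j h w hw]; simp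
    · have := hr.2.2
      unfold wordProd at this ⊢
      rw [List.map_append, List.prod_append, this]; simp
  rw [← TofWord_eq this]
  simp [TofWord, Tw]

lemma Tg_mul_Tw (n j : ℕ) (h : j + 1 < n) (w : Equiv.Perm (Fin n)) :
    Tg n j * Tw n w = if LA n w j h then Tw n (sgen n j * w) else
      (tt - 1) • Tw n w + tt • Tw n (sgen n j * w) := by
  split_ifs with hw
  · rw [Tw_left n j h w hw]
  · have := Tw_left n j h (sgen n j * w) ((LA_sgen n j h w).2 hw)
    rw [sgen_cancel] at this
    rw [this, ← mul_assoc, Tg_quad n j h, add_mul, smul_mul_assoc, Algebra.smul_def tt]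

/-- inverse of `t` -/
def ti : HR := LaurentPolynomial.T (-1)

lemma tt_ti : tt * ti = 1 := by
  unfold tt ti
  rw [← LaurentPolynomial.T_add]; simp

/-- `t T_j⁻¹` -/
def Ti (n j : ℕ) : H n := Tg n j + (1 - tt) • 1

lemma Tg_Ti (n j : ℕ) (h : j + 1 < n) : Tg n j * Ti n j = tt • 1 := by
  unfold Ti
  rw [mul_add, Tg_quad n j h, mul_smul_comm, mul_one, Algebra.algebraMap_eq_smul_one,
    add_right_comm, ← add_smul]
  simp

lemma Ti_Tg (n j : ℕ) (h : j + 1 < n) : Ti n j * Tg n j = tt • 1 := by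
  unfold Ti
  rw [add_mul, Tg_quad n j h, smul_mul_assoc, one_mul, Algebra.algebraMap_eq_smul_one,
    add_right_comm, ← add_smul]
  simp
section JM
variable {B : Type} [Ring B] [Algebra HR B]

def jmX (τ : ℕ → B) : ℕ → B
  | 0 => 1
  | k + 1 => ti • (τ k * jmX τ k * τ k)

def jmXi (τi : ℕ → B) : ℕ → B
  | 0 => 1
  | k + 1 => tt • (τi k * jmXi τi k * τi k)

lemma jm_inv (τ τi : ℕ → B) (h1 : ∀ j, τ j * τi j = 1) (k : ℕ) :
    jmX τ k * jmXi τi k = 1 := by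
  induction k with
  | zero => simp [jmX, jmXi]
  | succ k ih =>
    have e : τ k * jmX τ k * τ k * (τi k * jmXi τi k * τi k) = 1 := by
      calc _ = τ k * (jmX τ k * (τ k * τi k) * jmXi τi k) * τi k := by simp only [mul_assoc]
        _ = 1 := by rw [h1, mul_one, ih, mul_one, h1]
    rw [jmX, jmXi, smul_mul_smul_comm, e, mul_comm, tt_ti, one_smul]

lemma jm_inv' (τ τi : ℕ → B) (h1 : ∀ j, τi j * τ j = 1) (k : ℕ) :
    jmXi τi k * jmX τ k = 1 := by
  induction k with
  | zero => simp [jmX, jmXi]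
  | succ k ih =>
    have e : τi k * jmXi τi k * τi k * (τ k * jmX τ k * τ k) = 1 := by
      calc _ = τi k * (jmXi τi k * (τi k * τ k) * jmX τ k) * τ k := by simp only [mul_assoc]
        _ = 1 := by rw [h1, mul_one, ih, mul_one, h1]
    rw [jmX, jmXi, smul_mul_smul_comm, e, tt_ti, one_smul]

lemma jm_comm1 (n : ℕ) (τ : ℕ → B)
    (hc : ∀ j k, j + 1 < k → k + 1 < n → τ j * τ k = τ k * τ j) (k : ℕ) :
    ∀ j, k < j → j + 1 < n → Commute (τ j) (jmX τ k) := by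
  induction k with
  | zero => intro j _ _; exact Commute.one_right _
  | succ k ih =>
    intro j hj hn
    have h : Commute (τ j) (τ k) := (hc k j hj hn).symm
    exact (((h.mul_right (ih j (by omega) hn)).mul_right h).smul_right _)

lemma jm_comm2 (n : ℕ) (τ : ℕ → B)
    (hb : ∀ j, j + 2 < n → τ j * τ (j+1) * τ j = τ (j+1) * τ j * τ (j+1))
    (hc : ∀ j k, j + 1 < k → k + 1 < n → τ j * τ k = τ k * τ j) (k : ℕ) :
    ∀ j, j + 1 < k → k < n → Commute (τ j) (jmX τ k) := by
  induction k with
  | zero => intro j h; omega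
  | succ m ih =>
    intro j hj hn
    by_cases hjm : j + 1 < m
    · have h : Commute (τ j) (τ m) := hc j m hjm hn
      exact (((h.mul_right (ih j hjm (by omega))).mul_right h).smul_right _)
    · obtain rfl : m = j + 1 := by omega
      rw [jmX, jmX]
      apply Commute.smul_right
      rw [mul_smul_comm, smul_mul_assoc]
      apply Commute.smul_right
      have h := jm_comm1 n τ hc j (j+1) (by omega) hn
      have b := hb j (by omega)
      unfold Commute SemiconjBy at *
      calc τ j * (τ (j + 1) * (τ j * jmX τ j * τ j) * τ (j + 1))
          = (τ j * τ (j + 1) * τ j) * jmX τ j * τ j * τ (j + 1) := by simp only [mul_assoc]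
        _ = τ (j+1) * τ j * (τ (j+1) * jmX τ j) * τ j * τ (j+1) := by rw [b]; simp only [mul_assoc]
        _ = τ (j+1) * τ j * jmX τ j * (τ (j+1) * τ j * τ (j+1)) := by rw [h]; simp only [mul_assoc]
        _ = _ := by rw [← b]; simp only [mul_assoc]

lemma jm_commX (n : ℕ) (τ : ℕ → B)
    (hb : ∀ j, j + 2 < n → τ j * τ (j+1) * τ j = τ (j+1) * τ j * τ (j+1))
    (hc : ∀ j k, j + 1 < k → k + 1 < n → τ j * τ k = τ k * τ j) (i : ℕ) (hi : i < n) (k : ℕ) :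
    k < i → Commute (jmX τ i) (jmX τ k) := by
  induction k with
  | zero => intro _; exact Commute.one_right _
  | succ k ih =>
    intro hk
    have h := (jm_comm2 n τ hb hc i k hk hi).symm
    exact (((h.mul_right (ih (by omega))).mul_right h).smul_right _)

lemma jm_commX' (n : ℕ) (τ : ℕ → B)
    (hb : ∀ j, j + 2 < n → τ j * τ (j+1) * τ j = τ (j+1) * τ j * τ (j+1))
    (hc : ∀ j k, j + 1 < k → k + 1 < n → τ j * τ k = τ k * τ j) (i k : ℕ) (hi : i < n)
    (hk : k < n) : jmX τ i * jmX τ k = jmX τ k * jmX τ i := by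
  rcases lt_trichotomy i k with h | rfl | h
  · exact (jm_commX n τ hb hc k hk i h).symm
  · rfl
  · exact jm_commX n τ hb hc i hi k h

/-- interpretation of generators -/
def genMap (n : ℕ) (τ τi : ℕ → B) : AGen n → B
  | AGen.T j => τ j
  | AGen.X i => jmX τ i
  | AGen.Xinv i => jmXi τi i

lemma genMap_rel (n : ℕ) (τ τi : ℕ → B) (hj : ∀ j, ¬ j + 1 < n → τ j = 1)
    (hq : ∀ j, j + 1 < n → τ j * τ j = (tt - 1) • τ j + algebraMap HR B tt)
    (h1 : ∀ j, τ j * τi j = 1) (h2 : ∀ j, τi j * τ j = 1)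
    (hb : ∀ j, j + 2 < n → τ j * τ (j+1) * τ j = τ (j+1) * τ j * τ (j+1))
    (hc : ∀ j k, j + 1 < k → k + 1 < n → τ j * τ k = τ k * τ j) :
    ∀ ⦃x y : FA n⦄, ARel n x y → FreeAlgebra.lift HR (genMap n τ τi) x =
      FreeAlgebra.lift HR (genMap n τ τi) y := by
  intro x y hxy
  cases hxy with
  | junk j h => simp only [fT, map_one, FreeAlgebra.lift_ι_apply, genMap]; exact hj j h
  | quad j h =>
    simp only [fT, map_mul, map_add, map_smul, AlgHom.commutes, FreeAlgebra.lift_ι_apply, genMap]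
    exact hq j h
  | braid j h =>
    simp only [fT, map_mul, FreeAlgebra.lift_ι_apply, genMap]; exact hb j h
  | commT j k h hk =>
    simp only [fT, map_mul, FreeAlgebra.lift_ι_apply, genMap]; exact hc j k h hk
  | commX i i' =>
    simp only [fX, map_mul, FreeAlgebra.lift_ι_apply, genMap]
    exact jm_commX' n τ hb hc _ _ i.2 i'.2
  | XinvL i =>
    simp only [fX, fXi, map_mul, map_one, FreeAlgebra.lift_ι_apply, genMap]
    exact jm_inv τ τi h1 _
  | XinvR i =>
    simp only [fX, fXi, map_mul, map_one, FreeAlgebra.lift_ι_apply, genMap]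
    exact jm_inv' τ τi h2 _
  | TXT j h =>
    simp only [fX, fT, map_mul, map_smul, FreeAlgebra.lift_ι_apply, genMap, jmX]
    rw [smul_smul, tt_ti, one_smul]
  | TXcomm j h i hi1 hi2 =>
    simp only [fX, fT, map_mul, FreeAlgebra.lift_ι_apply, genMap]
    rcases lt_or_gt_of_ne hi1 with h3 | h3
    · exact jm_comm1 n τ hc _ j h3 h
    · exact jm_comm2 n τ hb hc _ j (by omega) i.2

end JM

/-- regular module -/
abbrev RM (n : ℕ) : Type := Equiv.Perm (Fin n) →₀ HR

def ee (n : ℕ) (w : Equiv.Perm (Fin n)) : RM n := Finsupp.single w 1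

def tau (n j : ℕ) : Module.End HR (RM n) :=
  if h : j + 1 < n then Finsupp.linearCombination HR
    (fun w => if LA n w j h then ee n (sgen n j * w) else
      (tt - 1) • ee n w + tt • ee n (sgen n j * w))
  else 1

lemma tau_ee (n j : ℕ) (h : j + 1 < n) (w : Equiv.Perm (Fin n)) :
    tau n j (ee n w) = if LA n w j h then ee n (sgen n j * w) else
      (tt - 1) • ee n w + tt • ee n (sgen n j * w) := by
  unfold tau
  rw [dif_pos h, ee, Finsupp.linearCombination_single, one_smul]
  rfl

lemma tau_ee_pos (n j : ℕ) (h : j + 1 < n) (w : Equiv.Perm (Fin n)) (hw : LA n w j h) :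
    tau n j (ee n w) = ee n (sgen n j * w) := by rw [tau_ee n j h, if_pos hw]

lemma tau_ee_neg (n j : ℕ) (h : j + 1 < n) (w : Equiv.Perm (Fin n)) (hw : ¬ LA n w j h) :
    tau n j (ee n w) = (tt - 1) • ee n w + tt • ee n (sgen n j * w) := by
  rw [tau_ee n j h, if_neg hw]

lemma end_ext (n : ℕ) (f g : Module.End HR (RM n)) (h : ∀ w, f (ee n w) = g (ee n w)) : f = g :=
  Finsupp.lhom_ext' fun w => LinearMap.ext_ring (h w)

lemma tau_quad (n j : ℕ) (h : j + 1 < n) :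
    tau n j * tau n j = (tt - 1) • tau n j + algebraMap HR _ tt := by
  apply end_ext
  intro w
  simp only [Module.End.mul_apply, LinearMap.add_apply, LinearMap.smul_apply,
    Module.algebraMap_end_apply]
  by_cases hw : LA n w j h
  · rw [tau_ee_pos n j h w hw, tau_ee_neg n j h _ (by rw [LA_sgen]; simpa using hw), sgen_cancel]
  · rw [tau_ee_neg n j h w hw, map_add, map_smul, map_smul, tau_ee_neg n j h w hw,
      tau_ee_pos n j h _ (by rw [LA_sgen]; simpa using hw), sgen_cancel]

lemma tau_comm (n i j : ℕ) (hij : i + 1 < j) (hj : j + 1 < n) :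
    tau n i * tau n j = tau n j * tau n i := by
  have hi : i + 1 < n := by omega
  apply end_ext
  intro w
  have e1 : LA n (sgen n i * w) j hj ↔ LA n w j hj := by
    unfold LA
    rw [mul_inv_rev, sgen_inv, Equiv.Perm.mul_apply, Equiv.Perm.mul_apply,
        sgen_other n i hi _ (by simp; omega) (by simp; omega),
        sgen_other n i hi _ (by simp; omega) (by simp; omega)]
  have e2 : LA n (sgen n j * w) i hi ↔ LA n w i hi := by
    unfold LA
    rw [mul_inv_rev, sgen_inv, Equiv.Perm.mul_apply, Equiv.Perm.mul_apply,
        sgen_other n j hj _ (by simp; omega) (by simp; omega),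
        sgen_other n j hj _ (by simp; omega) (by simp; omega)]
  have hcm : sgen n i * (sgen n j * w) = sgen n j * (sgen n i * w) := by
    rw [← mul_assoc, sgen_comm n i j hij hj, mul_assoc]
  by_cases h1 : LA n w i hi <;> by_cases h2 : LA n w j hj <;>
    simp only [Module.End.mul_apply, tau_ee n i hi, tau_ee n j hj, h1, h2, e1, e2, if_true,
      if_false, map_add, map_smul, hcm] <;> module

lemma tau_braid (n j : ℕ) (hj : j + 2 < n) :
    tau n j * tau n (j+1) * tau n j = tau n (j+1) * tau n j * tau n (j+1) := by
  have hi : j + 1 < n := by omega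
  have hk : j + 1 + 1 < n := by omega
  apply end_ext
  intro w
  have o1 : sgen n j ⟨j + 1 + 1, hk⟩ = ⟨j + 1 + 1, hk⟩ :=
    sgen_other n j hi _ (by simp; omega) (by simp)
  have o2 : sgen n (j+1) ⟨j, by omega⟩ = ⟨j, by omega⟩ :=
    sgen_other n (j+1) hk _ (by simp) (by simp; omega)
  have o3 := sgen_lo n j hi
  have o4 := sgen_hi n j hi
  have o5 := sgen_lo n (j+1) hk
  have o6 := sgen_hi n (j+1) hk
  have hbr : sgen n j * (sgen n (j+1) * (sgen n j * w)) =
      sgen n (j+1) * (sgen n j * (sgen n (j+1) * w)) := by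
    have := sgen_braid n j hj
    simp only [mul_assoc] at this
    simpa only [mul_assoc] using congrArg (· * w) this
  have n1 : w⁻¹ ⟨j, by omega⟩ ≠ w⁻¹ ⟨j + 1, hi⟩ := by
    intro he; have := w⁻¹.injective he; simp at this
  have n2 : w⁻¹ ⟨j + 1, hi⟩ ≠ w⁻¹ ⟨j + 1 + 1, hk⟩ := by
    intro he; have := w⁻¹.injective he; simp at this
  have n3 : w⁻¹ ⟨j, by omega⟩ ≠ w⁻¹ ⟨j + 1 + 1, hk⟩ := by
    intro he; have := w⁻¹.injective he; simp at this; omega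
  rcases lt_or_gt_of_ne n1 with h1 | h1 <;> rcases lt_or_gt_of_ne n2 with h2 | h2 <;>
  rcases lt_or_gt_of_ne n3 with h3 | h3 <;>
  first
  | exact absurd (h1.trans h2) (not_lt.mpr h3.le)
  | exact absurd (h2.trans h1) (not_lt.mpr h3.le)
  | (have g1 := not_lt.mpr h1.le
     have g2 := not_lt.mpr h2.le
     have g3 := not_lt.mpr h3.le
     simp only [Module.End.mul_apply, tau_ee n j hi, tau_ee n (j+1) hk, LA, mul_inv_rev, sgen_inv,
       Equiv.Perm.mul_apply, o1, o2, o3, o4, o5, o6, h1, h2, h3, g1, g2, g3, if_true,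
       if_false, map_add, map_smul, hbr, sgen_cancel]
     try module)

def taui (n j : ℕ) : Module.End HR (RM n) :=
  if j + 1 < n then ti • (tau n j + (1 - tt) • 1) else 1

lemma tau_taui (n j : ℕ) : tau n j * taui n j = 1 := by
  unfold taui
  split_ifs with h
  · rw [mul_smul_comm, mul_add, tau_quad n j h, mul_smul_comm, mul_one,
      Algebra.algebraMap_eq_smul_one, add_right_comm, ← add_smul]
    simp [smul_smul, mul_comm ti, tt_ti]
  · simp [tau, h]

lemma taui_tau (n j : ℕ) : taui n j * tau n j = 1 := by
  unfold taui
  split_ifs with h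
  · rw [smul_mul_assoc, add_mul, tau_quad n j h, smul_mul_assoc, one_mul,
      Algebra.algebraMap_eq_smul_one, add_right_comm, ← add_smul]
    simp [smul_smul, mul_comm ti, tt_ti]
  · simp [tau, h]

def rho (n : ℕ) : H n →ₐ[HR] Module.End HR (RM n) :=
  RingQuot.liftAlgHom HR ⟨FreeAlgebra.lift HR (genMap n (tau n) (taui n)),
    genMap_rel n (tau n) (taui n) (fun j h => by simp [tau, h]) (tau_quad n) (tau_taui n)
      (taui_tau n) (tau_braid n) (fun j k h1 h2 => tau_comm n j k h1 h2)⟩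

lemma rho_Tg (n j : ℕ) : rho n (Tg n j) = tau n j := by
  unfold rho Tg fT
  rw [RingQuot.liftAlgHom_mkAlgHom_apply, FreeAlgebra.lift_ι_apply]
  rfl

def phi (n : ℕ) : H n →ₗ[HR] RM n :=
  (LinearMap.applyₗ (ee n 1)).comp (rho n).toLinearMap

lemma phi_apply (n : ℕ) (h : H n) : phi n h = rho n h (ee n 1) := rfl

lemma phi_word (n : ℕ) (l : List ℕ) : ∀ w, Red n l w → phi n (TofWord n l) = ee n w := by
  induction l with
  | nil =>
    intro w hw
    have : w = 1 := by rw [← hw.2.2, wordProd_nil]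
    rw [phi_apply, this]; simp [TofWord]
  | cons i l ih =>
    intro w hw
    obtain ⟨h, hd, hr⟩ := hw.tail
    have := ih _ hr
    rw [phi_apply] at this
    rw [phi_apply, TofWord_cons, map_mul, Module.End.mul_apply, this, rho_Tg,
      tau_ee_pos n i h _ ((LA_sgen n i h w).2 hd), sgen_cancel]

lemma phi_Tw (n : ℕ) (w : Equiv.Perm (Fin n)) : phi n (Tw n w) = ee n w :=
  phi_word n _ w (redWord_red n w)
lemma pinv_self {n : ℕ} (w : Equiv.Perm (Fin n)) (x : Fin n) : w⁻¹ (w x) = x :=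
  Equiv.symm_apply_apply w x

lemma pself_inv {n : ℕ} (w : Equiv.Perm (Fin n)) (x : Fin n) : w (w⁻¹ x) = x :=
  Equiv.apply_symm_apply w x

def MinRep (n ℓ : ℕ) (u : Equiv.Perm (Fin n)) : Prop :=
  ∀ a b : Fin n, a < b → ((b : ℕ) < ℓ ∨ ℓ ≤ (a : ℕ)) → u a < u b

def Stab (n ℓ : ℕ) (v : Equiv.Perm (Fin n)) : Prop :=
  ∀ x : Fin n, ((v x : ℕ) < ℓ ↔ (x : ℕ) < ℓ)

lemma stab_iff (n ℓ : ℕ) (v : Equiv.Perm (Fin n)) :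
    wAct n v (varpi n ℓ) = varpi n ℓ ↔ Stab n ℓ v := by
  constructor
  · intro h x
    have := congrFun h (v x)
    unfold wAct varpi at this
    rw [pinv_self] at this
    split_ifs at this with h1 h2 h2 <;> omega
  · intro h
    funext x
    have := h (v⁻¹ x)
    rw [pself_inv] at this
    unfold wAct varpi
    simp only [this]

lemma mem_stabFinset (n ℓ : ℕ) (v : Equiv.Perm (Fin n)) :
    v ∈ stabFinset n (varpi n ℓ) ↔ Stab n ℓ v := by
  unfold stabFinset
  rw [Finset.mem_filter, stab_iff]
  simp

lemma stab_induct (n ℓ : ℕ) (P : Equiv.Perm (Fin n) → Prop) (h1 : P 1)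
    (hs : ∀ v j, ∀ h : j + 1 < n, Stab n ℓ v → (j + 1 < ℓ ∨ ℓ ≤ j) →
      v ⟨j, Nat.lt_of_succ_lt h⟩ < v ⟨j + 1, h⟩ → P v → P (v * sgen n j)) :
    ∀ v, Stab n ℓ v → P v := by
  suffices ∀ k v, inv n v = k → Stab n ℓ v → P v from fun v hv => this _ v rfl hv
  intro k
  induction k with
  | zero =>
    intro v hv _
    by_cases hv1 : v = 1
    · rw [hv1]; exact h1
    · obtain ⟨j, h, hd⟩ := exists_descent n v hv1
      have := inv_down n j h v hd
      omega
  | succ k ih =>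
    intro v hk hv
    have hv1 : v⁻¹ ≠ 1 := by
      intro h
      rw [inv_eq_one] at h
      rw [h, inv_one] at hk; omega
    obtain ⟨j, h, hd⟩ := exists_descent n v⁻¹ hv1
    unfold LA at hd
    rw [_root_.inv_inv, not_lt] at hd
    have hne : v ⟨j + 1, h⟩ ≠ v ⟨j, Nat.lt_of_succ_lt h⟩ := by
      intro he; have := v.injective he; simp at this
    have hlt := lt_of_le_of_ne hd hne
    have hblock : j + 1 < ℓ ∨ ℓ ≤ j := by
      have a1 := hv ⟨j, Nat.lt_of_succ_lt h⟩
      have a2 := hv ⟨j + 1, h⟩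
      rw [Fin.lt_def] at hlt
      simp only at a1 a2
      omega
    have hst : Stab n ℓ (v * sgen n j) := by
      intro x
      rw [Equiv.Perm.mul_apply, hv, sgen_val n j h]
      split_ifs <;> omega
    have hasc : (v * sgen n j) ⟨j, Nat.lt_of_succ_lt h⟩ < (v * sgen n j) ⟨j + 1, h⟩ := by
      rw [Equiv.Perm.mul_apply, Equiv.Perm.mul_apply, sgen_lo n j h, sgen_hi n j h]
      exact hlt
    have hinv := inv_mul_sgen n j h _ hasc
    rw [sgen_cancel_right] at hinv
    have := hs (v * sgen n j) j h hst hblock hasc (ih _ (by omega) hst)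
    rwa [sgen_cancel_right] at this

lemma minRep_induct (n ℓ : ℕ) (P : Equiv.Perm (Fin n) → Prop) (h1 : P 1)
    (hs : ∀ u j, ∀ h : j + 1 < n, MinRep n ℓ u → LA n u j h →
      (u⁻¹ ⟨j, Nat.lt_of_succ_lt h⟩ : ℕ) < ℓ → ℓ ≤ (u⁻¹ ⟨j + 1, h⟩ : ℕ) →
      P u → P (sgen n j * u)) :
    ∀ u, MinRep n ℓ u → P u := by
  suffices ∀ k u, inv n u = k → MinRep n ℓ u → P u from fun v hv => this _ v rfl hv
  intro k
  induction k with
  | zero =>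
    intro v hv _
    by_cases hv1 : v = 1
    · rw [hv1]; exact h1
    · obtain ⟨j, h, hd⟩ := exists_descent n v hv1
      have := inv_down n j h v hd
      omega
  | succ k ih =>
    intro u hk hu
    have hu1 : u ≠ 1 := by
      rintro rfl
      rw [inv_one] at hk; omega
    obtain ⟨j, h, hd⟩ := exists_descent n u hu1
    have hinv := inv_down n j h u hd
    have hla := (LA_sgen n j h u).2 hd
    unfold LA at hd
    rw [not_lt] at hd
    have hne : u⁻¹ ⟨j + 1, h⟩ ≠ u⁻¹ ⟨j, Nat.lt_of_succ_lt h⟩ := by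
      intro he; have := u⁻¹.injective he; simp at this
    have hlt := lt_of_le_of_ne hd hne
    have hbl := hu _ _ hlt
    rw [pself_inv, pself_inv] at hbl
    have hbl2 : ¬ ((u⁻¹ ⟨j, Nat.lt_of_succ_lt h⟩ : ℕ) < ℓ ∨ ℓ ≤ (u⁻¹ ⟨j + 1, h⟩ : ℕ)) := by
      intro hh
      have := hbl hh
      rw [Fin.lt_def] at this
      simp at this
    have hm : MinRep n ℓ (sgen n j * u) := by
      intro a b hab hb
      rw [Equiv.Perm.mul_apply, Equiv.Perm.mul_apply]
      apply sgen_lt n j h _ _ (hu a b hab hb)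
      rintro ⟨e1, e2⟩
      have e1' : a = u⁻¹ ⟨j, Nat.lt_of_succ_lt h⟩ := by
        rw [Equiv.Perm.eq_inv_iff_eq]; exact Fin.ext e1
      have e2' : b = u⁻¹ ⟨j+1, h⟩ := by
        rw [Equiv.Perm.eq_inv_iff_eq]; exact Fin.ext e2
      rw [e1', e2'] at hab
      exact absurd hab (not_lt.mpr hlt.le)
    have := hs (sgen n j * u) j h hm hla ?_ ?_ (ih _ (by omega) hm)
    · rwa [sgen_cancel] at this
    · rw [mul_inv_rev, sgen_inv, Equiv.Perm.mul_apply, sgen_lo n j h]; omega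
    · rw [mul_inv_rev, sgen_inv, Equiv.Perm.mul_apply, sgen_hi n j h]; omega

lemma Tw_mul_stab (n ℓ : ℕ) (u : Equiv.Perm (Fin n)) (hu : MinRep n ℓ u) :
    ∀ v, Stab n ℓ v → Tw n u * Tw n v = Tw n (u * v) := by
  apply stab_induct
  · rw [Tw_one, mul_one, mul_one]
  · intro v j h hv hb hlt ih
    rw [Tw_right n j h v hlt, ← mul_assoc, ih, ← mul_assoc, Tw_right n j h]
    rw [Equiv.Perm.mul_apply, Equiv.Perm.mul_apply]
    apply hu _ _ hlt
    have a1 := hv ⟨j, Nat.lt_of_succ_lt h⟩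
    have a2 := hv ⟨j + 1, h⟩
    simp only at a1 a2
    omega

/-- image of the first `ℓ` letters -/
def img (n ℓ : ℕ) (w : Equiv.Perm (Fin n)) : Finset (Fin n) :=
  Finset.univ.filter fun y => ((w⁻¹ y : Fin n) : ℕ) < ℓ

lemma mem_img (n ℓ : ℕ) (w : Equiv.Perm (Fin n)) (y : Fin n) :
    y ∈ img n ℓ w ↔ ((w⁻¹ y : Fin n) : ℕ) < ℓ := by simp [img]

lemma card_img (n ℓ : ℕ) (hℓ : ℓ ≤ n) (w : Equiv.Perm (Fin n)) : (img n ℓ w).card = ℓ := by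
  have : img n ℓ w = (Finset.univ.filter fun y : Fin n => (y : ℕ) < ℓ).map w.toEmbedding := by
    ext y
    rw [mem_img, Finset.mem_map_equiv]
    simp
  rw [this, Finset.card_map]
  simp [Fin.card_filter_val_lt, hℓ]

lemma colPerm_lo (n : ℕ) (C : Finset (Fin n)) (x : Fin n) (hx : (x : ℕ) < C.card) :
    colPerm n C x = C.orderIsoOfFin rfl ⟨x, hx⟩ := by
  have hx' : finSumFinEquiv.symm ((finCongr ((Nat.add_sub_cancel' (col_card_le n C)).symm)) x)
      = Sum.inl ⟨x, hx⟩ := by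
    rw [Equiv.symm_apply_eq]
    apply Fin.ext; simp
  simp only [colPerm, Equiv.trans_apply, hx']
  simp

lemma colPerm_hi (n : ℕ) (C : Finset (Fin n)) (x : Fin n) (hx : C.card ≤ (x : ℕ)) :
    colPerm n C x = (Cᶜ.orderIsoOfFin (k := n - C.card) (by simp [Finset.card_compl])
      ⟨x - C.card, by omega⟩ : Fin n) := by
  have hx' : finSumFinEquiv.symm ((finCongr ((Nat.add_sub_cancel' (col_card_le n C)).symm)) x)
      = Sum.inr ⟨x - C.card, by omega⟩ := by
    rw [Equiv.symm_apply_eq]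
    apply Fin.ext; simp; omega
  simp only [colPerm, Equiv.trans_apply, hx']
  simp

lemma colPerm_mem (n : ℕ) (C : Finset (Fin n)) (x : Fin n) :
    colPerm n C x ∈ C ↔ (x : ℕ) < C.card := by
  by_cases hx : (x : ℕ) < C.card
  · rw [colPerm_lo n C x hx]
    simp [hx]
  · rw [colPerm_hi n C x (by omega)]
    simp only [hx, iff_false]
    rw [← Finset.mem_compl]
    exact Subtype.coe_prop _

lemma colPerm_minRep (n : ℕ) (C : Finset (Fin n)) : MinRep n C.card (colPerm n C) := by
  intro a b hab hb
  rw [Fin.lt_def] at hab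
  rcases hb with hb | hb
  · rw [colPerm_lo n C a (by omega), colPerm_lo n C b hb, Subtype.coe_lt_coe,
      OrderIso.lt_iff_lt]
    exact hab
  · rw [colPerm_hi n C a hb, colPerm_hi n C b (by omega), Subtype.coe_lt_coe,
      OrderIso.lt_iff_lt, Fin.lt_def]
    simp; omega

lemma img_colPerm_mul (n : ℕ) (C : Finset (Fin n)) (v : Equiv.Perm (Fin n))
    (hv : Stab n C.card v) : img n C.card (colPerm n C * v) = C := by
  ext y
  rw [mem_img, mul_inv_rev, Equiv.Perm.mul_apply, ← hv, pself_inv,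
    ← colPerm_mem, pself_inv]

lemma img_colPerm (n : ℕ) (C : Finset (Fin n)) : img n C.card (colPerm n C) = C := by
  have := img_colPerm_mul n C 1 (fun x => by simp)
  rwa [mul_one] at this

lemma stab_of_img (n : ℕ) (C : Finset (Fin n)) (w : Equiv.Perm (Fin n))
    (hw : img n C.card w = C) : Stab n C.card ((colPerm n C)⁻¹ * w) := by
  intro x
  rw [← colPerm_mem, Equiv.Perm.mul_apply, pself_inv]
  conv_lhs => rw [← hw]
  rw [mem_img, pinv_self]

/-- element with given coefficients -/
def ofc (n : ℕ) (c : Equiv.Perm (Fin n) → HR) : H n := ∑ x, c x • Tw n x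

lemma phi_ofc (n : ℕ) (c : Equiv.Perm (Fin n) → HR) (y : Equiv.Perm (Fin n)) :
    phi n (ofc n c) y = c y := by
  unfold ofc
  simp only [map_sum, map_smul, phi_Tw, ee, Finsupp.coe_finsetSum, Finset.sum_apply,
    Finsupp.smul_apply, Finsupp.single_apply, smul_eq_mul]
  simp

lemma ofc_inj (n : ℕ) (c c' : Equiv.Perm (Fin n) → HR) (h : ofc n c = ofc n c') : c = c' := by
  funext y
  rw [← phi_ofc n c, h, phi_ofc]

lemma mem_colFinset (n ℓ : ℕ) (C : Finset (Fin n)) : C ∈ colFinset n ℓ ↔ C.card = ℓ := by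
  simp [colFinset]

def coefPart (n ℓ : ℕ) (c : Equiv.Perm (Fin n) → HR) (F : Finset (Fin n)) : H n :=
  ∑ v ∈ stabFinset n (varpi n ℓ), c (colPerm n F * v) • Tw n v

lemma ofc_decomp (n ℓ : ℕ) (hℓ : ℓ ≤ n) (c : Equiv.Perm (Fin n) → HR) :
    ofc n c = ∑ F ∈ colFinset n ℓ, Tw n (colPerm n F) * coefPart n ℓ c F := by
  unfold ofc coefPart
  rw [← Finset.sum_fiberwise_of_maps_to (s := Finset.univ) (t := colFinset n ℓ)
    (g := img n ℓ) (fun x _ => (mem_colFinset n ℓ _).2 (card_img n ℓ hℓ x))]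
  apply Finset.sum_congr rfl
  intro F hF
  obtain rfl := (mem_colFinset n _ F).1 hF
  rw [Finset.mul_sum]
  symm
  apply Finset.sum_equiv (Equiv.mulLeft (colPerm n F))
  · intro v
    rw [mem_stabFinset]
    simp only [Finset.mem_filter, Finset.mem_univ, true_and, Equiv.coe_mulLeft]
    constructor
    · exact img_colPerm_mul n F v
    · intro h
      have := stab_of_img n F _ h
      rwa [inv_mul_cancel_left] at this
  · intro v hv
    rw [mem_stabFinset] at hv
    rw [mul_smul_comm, Tw_mul_stab n _ _ (colPerm_minRep n F) v hv]
    rfl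

lemma coefPart_mem (n ℓ : ℕ) (c : Equiv.Perm (Fin n) → HR) (F : Finset (Fin n)) :
    coefPart n ℓ c F ∈ HparaM n (varpi n ℓ) := by
  unfold coefPart HparaM
  apply Submodule.sum_mem
  intro v hv
  apply Submodule.smul_mem
  apply Submodule.subset_span
  refine ⟨v, ?_, rfl⟩
  simpa [stabFinset] using hv

lemma HparaM_ex (n ℓ : ℕ) (g : H n) (hg : g ∈ HparaM n (varpi n ℓ)) :
    ∃ d : Equiv.Perm (Fin n) → HR, g = ∑ v ∈ stabFinset n (varpi n ℓ), d v • Tw n v := by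
  unfold HparaM at hg
  induction hg using Submodule.span_induction with
  | mem x hx =>
    obtain ⟨v, hv, rfl⟩ := hx
    refine ⟨fun y => if y = v then 1 else 0, ?_⟩
    have : v ∈ stabFinset n (varpi n ℓ) := by simpa [stabFinset] using hv
    simp [ite_smul, this]
  | zero => exact ⟨fun _ => 0, by simp⟩
  | add x y _ _ hx hy =>
    obtain ⟨d, rfl⟩ := hx
    obtain ⟨d', rfl⟩ := hy
    exact ⟨fun v => d v + d' v, by simp [add_smul, Finset.sum_add_distrib]⟩
  | smul a x _ hx =>
    obtain ⟨d, rfl⟩ := hx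
    exact ⟨fun v => a * d v, by simp [Finset.smul_sum, mul_smul]⟩

lemma paraCoeff_ofc (n ℓ : ℕ) (c : Equiv.Perm (Fin n) → HR) (C : Finset (Fin n))
    (hC : C.card = ℓ) : paraCoeff n ℓ (ofc n c) C = coefPart n ℓ c C := by
  have hℓ : ℓ ≤ n := hC ▸ col_card_le n C
  have hex : ∃ g : Finset (Fin n) → H n,
      (∀ F : Finset (Fin n), F.card = ℓ → g F ∈ HparaM n (varpi n ℓ)) ∧
      ofc n c = ∑ F ∈ colFinset n ℓ, Tw n (colPerm n F) * g F :=
    ⟨coefPart n ℓ c, fun F _ => coefPart_mem n ℓ c F, ofc_decomp n ℓ hℓ c⟩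
  unfold paraCoeff
  rw [dif_pos hex]
  obtain ⟨h1, h2⟩ := hex.choose_spec
  generalize hex.choose = g at h1 h2 ⊢
  have : ∀ F : Finset (Fin n), ∃ d : Equiv.Perm (Fin n) → HR, F.card = ℓ →
      g F = ∑ v ∈ stabFinset n (varpi n ℓ), d v • Tw n v := by
    intro F
    by_cases hF : F.card = ℓ
    · obtain ⟨d, hd⟩ := HparaM_ex n ℓ _ (h1 F hF)
      exact ⟨d, fun _ => hd⟩
    · exact ⟨fun _ => 0, fun h => absurd h hF⟩
  choose d hd using this
  have key : ∀ F : Finset (Fin n), F.card = ℓ →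
      coefPart n ℓ (fun x => d (img n ℓ x) ((colPerm n (img n ℓ x))⁻¹ * x)) F = g F := by
    intro F hF
    rw [hd F hF]
    unfold coefPart
    apply Finset.sum_congr rfl
    intro v hv
    rw [mem_stabFinset] at hv
    subst hF
    simp only [img_colPerm_mul n F v hv, inv_mul_cancel_left]
  have h3 : ofc n (fun x => d (img n ℓ x) ((colPerm n (img n ℓ x))⁻¹ * x)) = ofc n c := by
    rw [h2, ofc_decomp n ℓ hℓ]
    apply Finset.sum_congr rfl
    intro F hF
    rw [key F ((mem_colFinset n ℓ F).1 hF)]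
  rw [← key C hC, ofc_inj n _ _ h3]

lemma one0_eq (n : ℕ) : one0 n = ofc n (fun _ => 1) := by simp [one0, ofc]

lemma Psi_cons (n : ℕ) (C : Finset (Fin n)) (S : List (Finset (Fin n))) :
    Psi n (C :: S) = tpow n (len n (colPerm n C)) * Ring.inverse (Tw n (colPerm n C)⁻¹) *
      paraCoeff n C.card (Psi n S) C := by
  cases S with
  | nil =>
    rw [Psi, Psi, one0_eq, paraCoeff_ofc n _ _ C rfl]
    simp [coefPart, onePara]
  | cons D S => rw [Psi]; simp
/-- `∏ t T_j⁻¹` along a word -/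
def TiW (n : ℕ) (l : List ℕ) : H n := (l.map (Ti n)).prod

lemma TiW_cons (n i : ℕ) (l : List ℕ) : TiW n (i :: l) = Ti n i * TiW n l := by simp [TiW]

lemma TofWord_rev_cons (n i : ℕ) (l : List ℕ) :
    TofWord n (i :: l).reverse = TofWord n l.reverse * Tg n i := by simp [TofWord]

lemma TW1 (n : ℕ) (l : List ℕ) (hl : ∀ j ∈ l, j + 1 < n) :
    TofWord n l.reverse * TiW n l = (tt ^ l.length) • 1 := by
  induction l with
  | nil => simp [TofWord, TiW]
  | cons i l ih =>
    have ih := ih (fun j hj => hl j (by simp [hj]))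
    rw [TofWord_rev_cons, TiW_cons, mul_assoc, ← mul_assoc (Tg n i), Tg_Ti n i (hl i (by simp)),
      smul_mul_assoc, one_mul, mul_smul_comm, ih, smul_smul, List.length_cons, pow_succ, mul_comm]

lemma TW2 (n : ℕ) (l : List ℕ) (hl : ∀ j ∈ l, j + 1 < n) :
    TiW n l * TofWord n l.reverse = (tt ^ l.length) • 1 := by
  induction l with
  | nil => simp [TofWord, TiW]
  | cons i l ih =>
    have ih := ih (fun j hj => hl j (by simp [hj]))
    rw [TofWord_rev_cons, TiW_cons, mul_assoc, ← mul_assoc (TiW n l), ih,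
      smul_mul_assoc, one_mul, mul_smul_comm, Ti_Tg n i (hl i (by simp)), smul_smul,
      List.length_cons, pow_succ]

lemma wordProd_reverse (n : ℕ) (l : List ℕ) : wordProd n l.reverse = (wordProd n l)⁻¹ := by
  induction l with
  | nil => simp [wordProd]
  | cons i l ih =>
    rw [wordProd_cons, mul_inv_rev, ← ih, sgen_inv]
    simp [wordProd]

lemma Red.reverse {n : ℕ} {l : List ℕ} {w : Equiv.Perm (Fin n)} (h : Red n l w) :
    Red n l.reverse w⁻¹ :=
  ⟨fun j hj => h.1 j (List.mem_reverse.1 hj), by rw [List.length_reverse, h.2.1, inv_inv],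
    by rw [wordProd_reverse, h.2.2]⟩

lemma tti_pow (k : ℕ) : tt ^ k * ti ^ k = 1 := by rw [← mul_pow, tt_ti, one_pow]

/-- `t^{ℓ(u)} (T_{u⁻¹})⁻¹` -/
def Tinv (n : ℕ) (u : Equiv.Perm (Fin n)) : H n :=
  tpow n (len n u) * Ring.inverse (Tw n u⁻¹)

lemma Tinv_eq {n : ℕ} {l : List ℕ} {u : Equiv.Perm (Fin n)} (h : Red n l u) :
    Tinv n u = TiW n l := by
  have e1 := TW1 n l h.1
  have e2 := TW2 n l h.1
  rw [TofWord_eq h.reverse] at e1 e2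
  have hinv : Ring.inverse (Tw n u⁻¹) = (ti ^ l.length) • TiW n l := by
    have a1 : Tw n u⁻¹ * ((ti ^ l.length) • TiW n l) = 1 := by
      rw [mul_smul_comm, e1, smul_smul, mul_comm, tti_pow, one_smul]
    have a2 : ((ti ^ l.length) • TiW n l) * Tw n u⁻¹ = 1 := by
      rw [smul_mul_assoc, e2, smul_smul, mul_comm, tti_pow, one_smul]
    exact Ring.inverse_unit ⟨Tw n u⁻¹, _, a1, a2⟩
  unfold Tinv
  rw [hinv, len_eq, ← h.2.1, tpow, ← Algebra.smul_def, smul_smul, tti_pow, one_smul]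

lemma Tinv_one (n : ℕ) : Tinv n 1 = 1 := by
  rw [Tinv_eq (l := []) ⟨by simp, by simp [inv_one], wordProd_nil n⟩]
  simp [TiW]

lemma Tinv_left (n j : ℕ) (h : j + 1 < n) (w : Equiv.Perm (Fin n)) (hw : LA n w j h) :
    Tinv n (sgen n j * w) = Ti n j * Tinv n w := by
  have hr := redWord_red n w
  have : Red n (j :: redWord n w) (sgen n j * w) := by
    refine Red.cons h ?_ ?_
    · rw [LA_sgen]; simpa using hw
    · rw [sgen_cancel]; exact hr
  rw [Tinv_eq this, TiW_cons, Tinv_eq hr]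

/-! monomials -/

lemma ofFn_prod_mul {M : Type*} [Monoid M] (k : ℕ) : ∀ (f g : Fin k → M),
    (∀ i j, Commute (f i) (g j)) →
    (List.ofFn fun i => f i * g i).prod = (List.ofFn f).prod * (List.ofFn g).prod := by
  induction k with
  | zero => intro f g _; simp
  | succ k ih =>
    intro f g h
    rw [List.ofFn_succ, List.ofFn_succ, List.ofFn_succ, List.prod_cons, List.prod_cons,
      List.prod_cons, ih (fun i => f i.succ) (fun i => g i.succ) (fun i j => h _ _)]
    have : Commute (List.ofFn fun i : Fin k => f i.succ).prod (g 0) := by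
      apply Commute.list_prod_left
      intro x hx
      obtain ⟨i, rfl⟩ := (List.mem_ofFn' _ _).1 hx
      exact h _ _
    simp only [mul_assoc]
    rw [← mul_assoc (g 0), ← this.eq, mul_assoc]

lemma Xmon_nonneg (n : ℕ) (μ : Fin n → ℤ) (hμ : ∀ i, 0 ≤ μ i) :
    Xmon n μ = (List.ofFn fun i : Fin n => Xg n i ^ (μ i).toNat).prod := by
  unfold Xmon
  congr 2
  funext i
  rw [if_pos (hμ i)]

lemma Xmon_add (n : ℕ) (μ ν : Fin n → ℤ) (hμ : ∀ i, 0 ≤ μ i) (hν : ∀ i, 0 ≤ ν i) :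
    Xmon n (μ + ν) = Xmon n μ * Xmon n ν := by
  rw [Xmon_nonneg n μ hμ, Xmon_nonneg n ν hν,
    Xmon_nonneg n (μ + ν) (fun i => add_nonneg (hμ i) (hν i)), ← ofFn_prod_mul]
  · congr 2
    funext i
    rw [Pi.add_apply, Int.toNat_add (hμ i) (hν i), pow_add]
  · intro i j
    exact (show Commute (Xg n i) (Xg n j) from Xg_comm n i j).pow_pow _ _

lemma Xmon_comm (n : ℕ) (μ ν : Fin n → ℤ) (hμ : ∀ i, 0 ≤ μ i) (hν : ∀ i, 0 ≤ ν i) :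
    Xmon n μ * Xmon n ν = Xmon n ν * Xmon n μ := by
  rw [← Xmon_add n μ ν hμ hν, ← Xmon_add n ν μ hν hμ, add_comm]

lemma ofFn_prod_single {M : Type*} [Monoid M] (k : ℕ) : ∀ (f : Fin k → M) (i : Fin k),
    (∀ j, j ≠ i → f j = 1) → (List.ofFn f).prod = f i := by
  induction k with
  | zero => intro f i; exact i.elim0
  | succ k ih =>
    intro f i h
    rw [List.ofFn_succ, List.prod_cons]
    cases i using Fin.cases with
    | zero =>
      have : (fun i : Fin k => f i.succ) = fun _ => 1 := by
        funext j; exact h _ (Fin.succ_ne_zero j)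
      rw [this]; simp
    | succ i =>
      rw [h 0 (Fin.succ_ne_zero i).symm, one_mul]
      exact ih (fun i => f i.succ) i (fun j hj => h _ (fun he => hj (Fin.succ_injective _ he)))

lemma eps_nonneg (n : ℕ) (i k : Fin n) : 0 ≤ eps n i k := by
  unfold eps; split_ifs <;> simp

lemma vecOf_nonneg (n : ℕ) (C : Finset (Fin n)) (k : Fin n) : 0 ≤ vecOf n C k := by
  unfold vecOf; split_ifs <;> simp

lemma Xmon_eps (n : ℕ) (i : Fin n) : Xmon n (eps n i) = Xg n i := by
  rw [Xmon_nonneg n _ (eps_nonneg n i), ofFn_prod_single n _ i]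
  · simp [eps]
  · intro j hj
    simp [eps, hj]

lemma Xmon_T_comm (n j : ℕ) (h : j + 1 < n) (μ : Fin n → ℤ) (hμ : ∀ i, 0 ≤ μ i)
    (h0 : ∀ i : Fin n, ((i : ℕ) = j ∨ (i : ℕ) = j + 1) → μ i = 0) :
    Commute (Tg n j) (Xmon n μ) := by
  rw [Xmon_nonneg n μ hμ]
  apply Commute.list_prod_right
  intro x hx
  obtain ⟨i, rfl⟩ := (List.mem_ofFn' _ _).1 hx
  by_cases hi : (i : ℕ) = j ∨ (i : ℕ) = j + 1
  · simp [h0 i hi]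
  · push Not at hi
    exact (show Commute (Tg n j) (Xg n i) from TXcomm n j h i hi.1 hi.2).pow_right _

lemma tt_cancel (n : ℕ) (a b : H n) (h : tt • a = tt • b) : a = b := by
  have := congrArg (fun x => ti • x) h
  simp only [smul_smul, mul_comm ti, tt_ti, one_smul] at this
  exact this

lemma T_X (n j : ℕ) (h : j + 1 < n) :
    Tg n j * Xg n ⟨j, Nat.lt_of_succ_lt h⟩ = Xg n ⟨j + 1, h⟩ * Ti n j := by
  apply tt_cancel
  rw [← smul_mul_assoc tt (Xg n ⟨j + 1, h⟩), ← TXT n j h, mul_assoc _ (Tg n j) (Ti n j), Tg_Ti n j h, mul_smul_comm, mul_one]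

lemma Ti_X (n j : ℕ) (h : j + 1 < n) :
    Ti n j * Xg n ⟨j + 1, h⟩ = Xg n ⟨j, Nat.lt_of_succ_lt h⟩ * Tg n j := by
  apply tt_cancel
  rw [← mul_smul_comm tt (Ti n j), ← TXT n j h, mul_assoc, ← mul_assoc (Ti n j), Ti_Tg n j h, smul_mul_assoc, one_mul]

lemma T_XX (n j : ℕ) (h : j + 1 < n) :
    Commute (Tg n j) (Xg n ⟨j, Nat.lt_of_succ_lt h⟩ * Xg n ⟨j + 1, h⟩) := by
  unfold Commute SemiconjBy
  rw [← mul_assoc, T_X, mul_assoc, Ti_X, ← mul_assoc, Xg_comm]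

/-- part of a column away from `j, j+1` -/
def away (n j : ℕ) (C : Finset (Fin n)) : Finset (Fin n) :=
  C.filter fun x => (x : ℕ) ≠ j ∧ (x : ℕ) ≠ j + 1

lemma away_comm (n j : ℕ) (h : j + 1 < n) (C : Finset (Fin n)) :
    Commute (Tg n j) (Xmon n (vecOf n (away n j C))) := by
  apply Xmon_T_comm n j h _ (vecOf_nonneg n _)
  intro i hi
  unfold vecOf away
  rw [if_neg]
  simp only [Finset.mem_filter, not_and]
  intro _ h1 h2
  omega

lemma T_Xcol_same (n j : ℕ) (h : j + 1 < n) (C : Finset (Fin n))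
    (hC : (⟨j, Nat.lt_of_succ_lt h⟩ : Fin n) ∈ C ↔ (⟨j + 1, h⟩ : Fin n) ∈ C) :
    Commute (Tg n j) (Xmon n (vecOf n C)) := by
  by_cases hj : (⟨j + 1, h⟩ : Fin n) ∈ C
  · have hj' := hC.2 hj
    have : vecOf n C = vecOf n (away n j C) +
        (eps n ⟨j, Nat.lt_of_succ_lt h⟩ + eps n ⟨j + 1, h⟩) := by
      funext x
      simp only [vecOf, away, eps, Pi.add_apply, Finset.mem_filter, Fin.ext_iff]
      by_cases h1 : (x : ℕ) = j
      · have : x = ⟨j, Nat.lt_of_succ_lt h⟩ := Fin.ext h1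
        subst this; simp [hj']
      · by_cases h2 : (x : ℕ) = j + 1
        · have : x = ⟨j + 1, h⟩ := Fin.ext h2
          subst this; simp [hj]
        · simp [h1, h2]
    have hnn : ∀ i, 0 ≤ (eps n ⟨j, Nat.lt_of_succ_lt h⟩ + eps n ⟨j + 1, h⟩) i :=
      fun i => add_nonneg (eps_nonneg n _ i) (eps_nonneg n _ i)
    rw [this, Xmon_add _ _ _ (vecOf_nonneg n _) hnn, Xmon_add _ _ _ (eps_nonneg n _) (eps_nonneg n _), Xmon_eps, Xmon_eps]
    exact (away_comm n j h C).mul_right (T_XX n j h)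
  · have hj' := fun hh => hj (hC.1 hh)
    apply Xmon_T_comm n j h _ (vecOf_nonneg n _)
    intro i hi
    unfold vecOf
    rw [if_neg]
    rcases hi with hi | hi
    · have : i = ⟨j, Nat.lt_of_succ_lt h⟩ := Fin.ext hi
      rw [this]; exact hj'
    · have : i = ⟨j+1, h⟩ := Fin.ext hi
      rw [this]; exact hj

lemma T_Xcol_move (n j : ℕ) (h : j + 1 < n) (C D : Finset (Fin n))
    (h1 : (⟨j, Nat.lt_of_succ_lt h⟩ : Fin n) ∈ C) (h2 : (⟨j + 1, h⟩ : Fin n) ∉ C)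
    (hD : ∀ x, x ∈ D ↔ sgen n j x ∈ C) :
    Tg n j * Xmon n (vecOf n C) = Xmon n (vecOf n D) * Ti n j := by
  have e1 : vecOf n C = vecOf n (away n j C) + eps n ⟨j, Nat.lt_of_succ_lt h⟩ := by
    funext x
    simp only [vecOf, away, eps, Pi.add_apply, Finset.mem_filter, Fin.ext_iff]
    by_cases g1 : (x : ℕ) = j
    · have : x = ⟨j, Nat.lt_of_succ_lt h⟩ := Fin.ext g1
      subst this; simp [h1]
    · by_cases g2 : (x : ℕ) = j + 1
      · have : x = ⟨j + 1, h⟩ := Fin.ext g2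
        subst this; simp [h2]
      · simp [g1, g2]
  have e2 : vecOf n D = vecOf n (away n j C) + eps n ⟨j + 1, h⟩ := by
    funext x
    simp only [vecOf, away, eps, Pi.add_apply, Finset.mem_filter, Fin.ext_iff, hD]
    by_cases g1 : (x : ℕ) = j
    · have : x = ⟨j, Nat.lt_of_succ_lt h⟩ := Fin.ext g1
      subst this; simp [sgen_lo n j h, h2]
    · by_cases g2 : (x : ℕ) = j + 1
      · have : x = ⟨j + 1, h⟩ := Fin.ext g2
        subst this; simp [sgen_hi n j h, h1]
      · simp [g1, g2, sgen_other n j h x g1 g2]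
  rw [e1, e2, Xmon_add _ _ _ (vecOf_nonneg n _) (eps_nonneg n _),
    Xmon_add _ _ _ (vecOf_nonneg n _) (eps_nonneg n _), Xmon_eps, Xmon_eps, ← mul_assoc,
    (away_comm n j h C).eq, mul_assoc, T_X, mul_assoc]

lemma mem_img_sgen (n ℓ j : ℕ) (u : Equiv.Perm (Fin n)) (x : Fin n) :
    x ∈ img n ℓ (sgen n j * u) ↔ sgen n j x ∈ img n ℓ u := by
  rw [mem_img, mem_img, mul_inv_rev, sgen_inv, Equiv.Perm.mul_apply]

lemma img_one (n ℓ : ℕ) : img n ℓ 1 = hwCol n ℓ := by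
  ext x; simp [img, hwCol]

lemma varpi_eq (n ℓ : ℕ) : varpi n ℓ = vecOf n (hwCol n ℓ) := by
  funext x; simp [varpi, vecOf, hwCol]

lemma Tw_X_minRep (n ℓ : ℕ) : ∀ u : Equiv.Perm (Fin n), MinRep n ℓ u →
    Tw n u * Xmon n (varpi n ℓ) = Xmon n (vecOf n (img n ℓ u)) * Tinv n u := by
  apply minRep_induct
  · rw [Tw_one, Tinv_one, one_mul, mul_one, img_one, varpi_eq]
  · intro u j h hu hla h1 h2 ih
    rw [Tw_left n j h u hla, Tinv_left n j h u hla, mul_assoc, ih, ← mul_assoc,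
      T_Xcol_move n j h (img n ℓ u) (img n ℓ (sgen n j * u)) ((mem_img _ _ _ _).2 h1)
        (fun hh => by rw [mem_img] at hh; omega) (mem_img_sgen n ℓ j u), mul_assoc]

lemma Tw_X_stab (n ℓ : ℕ) : ∀ v : Equiv.Perm (Fin n), Stab n ℓ v →
    Commute (Tw n v) (Xmon n (varpi n ℓ)) := by
  apply stab_induct
  · rw [Tw_one]; exact Commute.one_left _
  · intro v j h hv hb hlt ih
    rw [Tw_right n j h v hlt]
    refine ih.mul_left ?_
    rw [varpi_eq]
    apply T_Xcol_same n j h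
    simp [hwCol]
    omega

lemma coefPart_X (n ℓ : ℕ) (c : Equiv.Perm (Fin n) → HR) (F : Finset (Fin n)) :
    coefPart n ℓ c F * Xmon n (varpi n ℓ) = Xmon n (varpi n ℓ) * coefPart n ℓ c F := by
  unfold coefPart
  rw [Finset.sum_mul, Finset.mul_sum]
  apply Finset.sum_congr rfl
  intro v hv
  rw [mem_stabFinset] at hv
  rw [smul_mul_assoc, mul_smul_comm, (Tw_X_stab n ℓ v hv).eq]

/-- one step of the recursion -/
lemma ofc_X (n ℓ : ℕ) (hℓ : ℓ ≤ n) (c : Equiv.Perm (Fin n) → HR) :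
    ofc n c * Xmon n (varpi n ℓ) = ∑ F ∈ colFinset n ℓ,
      Xmon n (vecOf n F) * (Tinv n (colPerm n F) * paraCoeff n ℓ (ofc n c) F) := by
  conv_lhs => rw [ofc_decomp n ℓ hℓ c]
  rw [Finset.sum_mul]
  apply Finset.sum_congr rfl
  intro F hF
  rw [mem_colFinset] at hF
  subst hF
  rw [mul_assoc, coefPart_X, ← mul_assoc, Tw_X_minRep n _ _ (colPerm_minRep n F), img_colPerm,
    paraCoeff_ofc n _ c F rfl, mul_assoc]
def cnt (n : ℕ) (C : Finset (Fin n)) (m : ℕ) : ℕ := (C.filter fun x : Fin n => (x : ℕ) < m).card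

lemma cnt_mono (n : ℕ) (C D : Finset (Fin n)) (h : C ⊆ D) (m : ℕ) : cnt n C m ≤ cnt n D m :=
  Finset.card_le_card (Finset.filter_subset_filter _ h)

lemma cnt_le_succ (n : ℕ) (C : Finset (Fin n)) (m : ℕ) : cnt n C m ≤ cnt n C (m + 1) := by
  apply Finset.card_le_card
  intro x
  simp only [Finset.mem_filter]
  rintro ⟨h1, h2⟩
  exact ⟨h1, by omega⟩

lemma cnt_sgen (n j : ℕ) (h : j + 1 < n) (C D : Finset (Fin n))
    (hD : ∀ x, x ∈ D ↔ sgen n j x ∈ C) (m : ℕ) (hm : m ≠ j + 1) : cnt n D m = cnt n C m := by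
  apply Finset.card_equiv (sgen n j)
  intro x
  simp only [Finset.mem_filter, hD]
  apply and_congr_right
  intro _
  rw [sgen_val n j h]
  split_ifs <;> omega

lemma cnt_notMem (n j : ℕ) (h : j < n) (C : Finset (Fin n)) (hC : (⟨j, h⟩ : Fin n) ∉ C) :
    cnt n C (j + 1) = cnt n C j := by
  unfold cnt
  congr 1
  apply Finset.filter_congr
  intro x hx
  have : (x : ℕ) ≠ j := by
    intro he
    apply hC
    have : x = ⟨j, h⟩ := Fin.ext he
    rwa [← this]
  omega

/-- allowed support -/
def Asup (n ℓ : ℕ) (C : Finset (Fin n)) : Set (Equiv.Perm (Fin n)) :=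
  {x | ∀ m, cnt n C m ≤ cnt n (img n ℓ x) m}

lemma img_stab (n ℓ : ℕ) (v : Equiv.Perm (Fin n)) (hv : Stab n ℓ v) : img n ℓ v = hwCol n ℓ := by
  ext x
  rw [mem_img, ← hv, pself_inv]
  simp [hwCol]

lemma Tinv_span (n ℓ : ℕ) (g : H n) (hg : g ∈ HparaM n (varpi n ℓ)) :
    ∀ u : Equiv.Perm (Fin n), MinRep n ℓ u →
      Tinv n u * g ∈ Submodule.span HR (Tw n '' Asup n ℓ (img n ℓ u)) := by
  apply minRep_induct
  · rw [Tinv_one, one_mul]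
    unfold HparaM at hg
    refine Submodule.span_mono ?_ hg
    apply Set.image_mono
    intro v hv
    have hv : wAct n v (varpi n ℓ) = varpi n ℓ := hv
    rw [stab_iff] at hv
    intro m
    rw [img_stab n ℓ v hv, img_one]
  · intro u j h hu hla h1 h2 ih
    rw [Tinv_left n j h u hla, mul_assoc]
    generalize Tinv n u * g = y at ih
    have hs := mem_img_sgen n ℓ j u
    have hjn : (⟨j, Nat.lt_of_succ_lt h⟩ : Fin n) ∉ img n ℓ (sgen n j * u) := by
      rw [hs, sgen_lo n j h, mem_img]; omega
    have hcj := cnt_notMem n j (Nat.lt_of_succ_lt h) _ hjn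
    have hce := cnt_sgen n j h _ _ hs
    have hcj2 := hce j (by omega)
    induction ih using Submodule.span_induction with
    | mem y hy =>
      obtain ⟨x, hx, rfl⟩ := hy
      have hsx := mem_img_sgen n ℓ j x
      have hcx := cnt_sgen n j h _ _ hsx
      have a1 : x ∈ Asup n ℓ (img n ℓ (sgen n j * u)) := by
        intro m
        refine le_trans ?_ (hx m)
        by_cases hm : m = j + 1
        · subst hm
          rw [hcj, hcj2]; exact cnt_le_succ _ _ _
        · exact (hce m hm).le
      have a2 : sgen n j * x ∈ Asup n ℓ (img n ℓ (sgen n j * u)) := by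
        intro m
        by_cases hm : m = j + 1
        · subst hm
          rw [hcj, hcj2]
          refine (hx j).trans ?_
          rw [← hcx j (by omega)]
          exact cnt_le_succ _ _ _
        · rw [hce m hm, hcx m hm]; exact hx m
      have b1 := Submodule.subset_span (R := HR) (Set.mem_image_of_mem (Tw n) a1)
      have b2 := Submodule.subset_span (R := HR) (Set.mem_image_of_mem (Tw n) a2)
      unfold Ti
      rw [add_mul, smul_mul_assoc, one_mul, Tg_mul_Tw n j h]
      refine Submodule.add_mem _ ?_ (Submodule.smul_mem _ _ b1)
      split_ifs
      · exact b2
      · exact Submodule.add_mem _ (Submodule.smul_mem _ _ b1) (Submodule.smul_mem _ _ b2)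
    | zero => rw [mul_zero]; exact Submodule.zero_mem _
    | add x y _ _ hx hy => rw [mul_add]; exact Submodule.add_mem _ hx hy
    | smul a x _ hx => rw [mul_smul_comm]; exact Submodule.smul_mem _ _ hx

lemma span_ofc (n : ℕ) (A : Set (Equiv.Perm (Fin n))) (g : H n)
    (hg : g ∈ Submodule.span HR (Tw n '' A)) :
    ∃ c, g = ofc n c ∧ ∀ x, x ∉ A → c x = 0 := by
  induction hg using Submodule.span_induction with
  | mem x hx =>
    obtain ⟨v, hv, rfl⟩ := hx
    refine ⟨fun y => if y = v then 1 else 0, by simp [ofc, ite_smul], ?_⟩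
    intro x hx
    have : x ≠ v := by rintro rfl; exact hx hv
    simp [this]
  | zero => exact ⟨fun _ => 0, by simp [ofc], fun _ _ => rfl⟩
  | add x y _ _ hx hy =>
    obtain ⟨d, rfl, h1⟩ := hx
    obtain ⟨d', rfl, h2⟩ := hy
    exact ⟨fun v => d v + d' v, by simp [ofc, add_smul, Finset.sum_add_distrib],
      fun x hx => by simp [h1 x hx, h2 x hx]⟩
  | smul a x _ hx =>
    obtain ⟨d, rfl, h1⟩ := hx
    exact ⟨fun v => a * d v, by simp [ofc, Finset.smul_sum, mul_smul],
      fun x hx => by simp [h1 x hx]⟩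

lemma Psi_cons_supp (n : ℕ) (C : Finset (Fin n)) (S : List (Finset (Fin n)))
    (c : Equiv.Perm (Fin n) → HR) (hc : Psi n S = ofc n c) :
    ∃ c', Psi n (C :: S) = ofc n c' ∧ ∀ x, x ∉ Asup n C.card C → c' x = 0 := by
  apply span_ofc
  rw [Psi_cons, hc, paraCoeff_ofc n _ c C rfl]
  have := Tinv_span n C.card _ (coefPart_mem n C.card c C) _ (colPerm_minRep n C)
  rw [img_colPerm] at this
  exact this

lemma Psi_ofc (n : ℕ) (S : List (Finset (Fin n))) : ∃ c, Psi n S = ofc n c := by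
  induction S with
  | nil => exact ⟨_, by rw [Psi]; exact one0_eq n⟩
  | cons C S ih =>
    obtain ⟨c, hc⟩ := ih
    obtain ⟨c', h, _⟩ := Psi_cons_supp n C S c hc
    exact ⟨c', h⟩

lemma nth_eq (n : ℕ) (C : Finset (Fin n)) (k : ℕ) (hk : k < C.card) :
    nth n C k = (C.orderEmbOfFin rfl ⟨k, hk⟩ : Fin n) := by
  unfold nth
  rw [Finset.orderEmbOfFin_apply, List.getD_eq_getElem _ _ (by simpa using hk), List.getElem_map]
  rfl

lemma pairSS_of_cnt (n : ℕ) (E C : Finset (Fin n)) (h : ∀ m, cnt n C m ≤ cnt n E m) :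
    pairSS n E C := by
  intro k hk
  rw [nth_eq n C k hk]
  set a := C.orderEmbOfFin rfl ⟨k, hk⟩ with ha
  have h1 : k + 1 ≤ cnt n C (a + 1) := by
    have : ((Finset.univ.filter fun i : Fin C.card => (i : ℕ) < k + 1).map
        (C.orderEmbOfFin rfl).toEmbedding).card ≤ cnt n C (a + 1) := by
      apply Finset.card_le_card
      intro x hx
      simp only [Finset.mem_map, Finset.mem_filter, Finset.mem_univ, true_and] at hx ⊢
      obtain ⟨i, hi, rfl⟩ := hx
      refine ⟨Finset.orderEmbOfFin_mem C rfl i, ?_⟩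
      have : C.orderEmbOfFin rfl i ≤ a := by
        rw [ha, OrderEmbedding.le_iff_le, Fin.le_def]
        simp; omega
      rw [Fin.le_def] at this
      exact Nat.lt_succ_of_le this
    rw [Finset.card_map, Fin.card_filter_val_lt] at this
    omega
  have h2 := h1.trans (h (a + 1))
  have h3 : k < E.card := by
    have : cnt n E (a + 1) ≤ E.card := Finset.card_filter_le _ _
    omega
  rw [nth_eq n E k h3]
  by_contra hlt
  push Not at hlt
  have h4 : cnt n E (a + 1) ≤ ((Finset.univ.filter fun i : Fin E.card => (i : ℕ) < k).map
        (E.orderEmbOfFin rfl).toEmbedding).card := by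
    apply Finset.card_le_card
    intro x hx
    simp only [Finset.mem_map, Finset.mem_filter, Finset.mem_univ, true_and] at hx ⊢
    obtain ⟨hxE, hxa⟩ := hx
    have hr : x ∈ Set.range (E.orderEmbOfFin rfl) := by
      rw [Finset.range_orderEmbOfFin]; exact hxE
    obtain ⟨i, rfl⟩ := hr
    refine ⟨i, ?_, rfl⟩
    have : E.orderEmbOfFin rfl i < E.orderEmbOfFin rfl ⟨k, h3⟩ := by
      rw [Fin.lt_def]; omega
    rw [OrderEmbedding.lt_iff_lt, Fin.lt_def] at this
    exact this
  rw [Finset.card_map, Fin.card_filter_val_lt] at h4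
  omega

lemma Psi_vanish (n : ℕ) (E C : Finset (Fin n)) (S : List (Finset (Fin n)))
    (hcard : C.card ≤ E.card) (hne : ¬ pairSS n E C) : Psi n (E :: C :: S) = 0 := by
  obtain ⟨c, hc⟩ := Psi_ofc n S
  obtain ⟨c', h1, h2⟩ := Psi_cons_supp n C S c hc
  rw [Psi_cons, h1, paraCoeff_ofc n _ c' E rfl]
  have : coefPart n E.card c' E = 0 := by
    unfold coefPart
    apply Finset.sum_eq_zero
    intro v hv
    rw [mem_stabFinset] at hv
    rw [h2, zero_smul]
    intro hA
    apply hne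
    apply pairSS_of_cnt
    intro m
    refine (hA m).trans ?_
    conv_rhs => rw [← img_colPerm_mul n E v hv]
    apply cnt_mono
    intro y
    rw [mem_img, mem_img]
    omega
  rw [this, mul_zero]
lemma wtVec_nil (n : ℕ) : wtVec n [] = 0 := by
  funext i; simp [wtVec]

lemma wtVec_cons (n : ℕ) (F : Finset (Fin n)) (L : List (Finset (Fin n))) :
    wtVec n (F :: L) = wtVec n L + vecOf n F := by
  funext i
  simp only [wtVec, vecOf, Pi.add_apply, List.filter_cons]
  by_cases h : i ∈ F <;> simp [h]

lemma wtVec_nonneg (n : ℕ) (L : List (Finset (Fin n))) (i : Fin n) : 0 ≤ wtVec n L i := by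
  simp [wtVec]

lemma Xmon_zero (n : ℕ) : Xmon n 0 = 1 := by
  rw [Xmon_nonneg n 0 (fun _ => le_rfl)]
  apply List.prod_eq_one
  intro x hx
  simp only [List.mem_ofFn] at hx
  obtain ⟨i, rfl⟩ := hx
  simp

lemma varpi_nonneg (n ℓ : ℕ) (i : Fin n) : 0 ≤ varpi n ℓ i := by
  unfold varpi; split_ifs <;> simp

lemma Psi_X (n ℓ : ℕ) (hℓ : ℓ ≤ n) (L : List (Finset (Fin n))) :
    Xmon n (wtVec n L) * Psi n L * Xmon n (varpi n ℓ) =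
      ∑ F : Finset (Fin n), if F.card = ℓ then
        Xmon n (wtVec n (F :: L)) * Psi n (F :: L) else 0 := by
  obtain ⟨c, hc⟩ := Psi_ofc n L
  rw [mul_assoc, hc, ofc_X n ℓ hℓ c, ← Finset.sum_filter, Finset.mul_sum]
  apply Finset.sum_congr rfl
  intro F hF
  have hF' : F.card = ℓ := by simpa [colFinset] using hF
  rw [wtVec_cons, Xmon_add n _ _ (wtVec_nonneg n L) (vecOf_nonneg n F), Psi_cons, hc, hF',
    Tinv]
  simp only [mul_assoc]

theorem mainG (n : ℕ) : ∀ (k : ℕ) (ℓ : Fin k → ℕ), Antitone ℓ → (∀ j, ℓ j ≤ n) →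
    one0 n * Xmon n (∑ j, varpi n (ℓ j)) =
      ∑ f : Fin k → Finset (Fin n), if (∀ j, (f j).card = ℓ j) ∧ isSSYT n (List.ofFn f) then
        Xmon n (wtVec n (List.ofFn f)) * Psi n (List.ofFn f) else 0 := by
  intro k
  induction k with
  | zero =>
    intro ℓ _ _
    have h1 : isSSYT n [] := List.isChain_nil
    simp [Xmon_zero, wtVec_nil, Psi, h1]
  | succ k ih =>
    intro ℓ hℓ hn
    have hsn : ∀ i, 0 ≤ (∑ j : Fin k, varpi n (ℓ j.succ)) i := by
      intro i
      rw [Finset.sum_apply]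
      exact Finset.sum_nonneg fun j _ => varpi_nonneg n _ i
    have e := ih (fun j => ℓ j.succ) (fun a b hab => hℓ (Fin.succ_le_succ_iff.2 hab))
      (fun j => hn _)
    rw [Fin.sum_univ_succ, add_comm, Xmon_add n _ _ hsn (varpi_nonneg n _), ← mul_assoc, e,
      Finset.sum_mul, ← (Fin.consEquiv fun _ : Fin (k+1) => Finset (Fin n)).sum_comp,
      Fintype.sum_prod_type, Finset.sum_comm]
    apply Finset.sum_congr rfl
    intro g _
    rw [ite_mul, zero_mul, Psi_X n _ (hn 0)]
    split_ifs with hg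
    · apply Finset.sum_congr rfl
      intro F _
      have hof : List.ofFn ((Fin.consEquiv fun _ : Fin (k+1) => Finset (Fin n)) (F, g))
          = F :: List.ofFn g := by
        rw [List.ofFn_succ]; simp [Fin.consEquiv]
      rw [hof]
      by_cases hF : F.card = ℓ 0
      · rw [if_pos hF]
        split_ifs with h2
        · rfl
        · have h3 : ¬ isSSYT n (F :: List.ofFn g) := by
            intro h4
            apply h2
            refine ⟨?_, h4⟩
            intro j
            refine Fin.cases ?_ (fun i => ?_) j
            · simpa [Fin.consEquiv] using hF
            · simpa [Fin.consEquiv] using hg.1 i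
          cases k with
          | zero =>
            exfalso; apply h3
            rw [List.ofFn_zero]
            exact List.isChain_singleton _
          | succ k =>
            rw [List.ofFn_succ] at h3 ⊢
            have hg2 := hg.2
            rw [List.ofFn_succ] at hg2
            have h5 : ¬ pairSS n F (g 0) := by
              intro h6
              exact h3 (List.isChain_cons_cons.2 ⟨h6, hg2⟩)
            rw [Psi_vanish n F (g 0) _ _ h5, mul_zero]
            rw [hF, hg.1 0]
            exact hℓ (Fin.zero_le _)
      · rw [if_neg hF, if_neg]
        intro h
        exact hF (by simpa [Fin.consEquiv] using h.1 0)
    · symm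
      apply Finset.sum_eq_zero
      intro F _
      rw [if_neg]
      rintro ⟨h1, h2⟩
      apply hg
      refine ⟨fun j => by simpa [Fin.consEquiv] using h1 j.succ, ?_⟩
      have hof : List.ofFn ((Fin.consEquiv fun _ : Fin (k+1) => Finset (Fin n)) (F, g))
          = F :: List.ofFn g := by
        rw [List.ofFn_succ]; simp [Fin.consEquiv]
      rw [hof] at h2
      exact List.IsChain.tail h2

lemma shape_iff (n : ℕ) (lam : Fin n → ℤ) (hdom : Antitone lam) (j : ℕ) (i : Fin n) :
    (i : ℕ) < shapeColLen n lam j ↔ (j : ℤ) < lam i := by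
  constructor
  · intro h
    by_contra hj
    have : shapeColLen n lam j ≤ (Finset.Iio i).card := by
      apply Finset.card_le_card
      intro x hx
      simp only [Finset.mem_filter, Finset.mem_univ, true_and, Finset.mem_Iio] at hx ⊢
      by_contra hxi
      have := hdom (not_lt.1 hxi)
      omega
    rw [Fin.card_Iio] at this
    omega
  · intro h
    have : (Finset.Iic i).card ≤ shapeColLen n lam j := by
      apply Finset.card_le_card
      intro x hx
      simp only [Finset.mem_filter, Finset.mem_univ, true_and, Finset.mem_Iic] at hx ⊢
      have := hdom hx
      omega
    rw [Fin.card_Iic] at this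
    omega

lemma lam_eq (n : ℕ) (lam : Fin n → ℤ) (hdom : Antitone lam) (hnn : ∀ i, 0 ≤ lam i) :
    lam = ∑ j : Fin (numCols n lam), varpi n (shapeColLen n lam (j : ℕ)) := by
  funext i
  have hle : (lam i).toNat ≤ numCols n lam :=
    Finset.le_sup (f := fun i : Fin n => (lam i).toNat) (Finset.mem_univ i)
  rw [Finset.sum_apply]
  simp only [varpi, shape_iff n lam hdom]
  rw [Fin.sum_univ_eq_sum_range (fun j : ℕ => if (j : ℤ) < lam i then (1 : ℤ) else 0),
    ← Finset.sum_filter, Finset.sum_const]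
  have : (Finset.range (numCols n lam)).filter (fun j : ℕ => (j : ℤ) < lam i)
      = Finset.range (lam i).toNat := by
    ext j
    simp only [Finset.mem_filter, Finset.mem_range]
    have := hnn i
    omega
  rw [this]
  have := hnn i
  simp [this]

/-- the affine Hecke algebra lift of Macdonald's formula:
`1₀ X^λ = Σ_{T ∈ B(λ)} X^T Ψ_T`, the sum over all semistandard Young tableaux of shape `λ`
with entries in `[n]` (encoded as their sequences of columns, leftmost first). -/
theorem stmt12 (n : ℕ) (hn : 1 ≤ n) (lam : Fin n → ℤ)
    (hdom : Antitone lam) (hnonneg : ∀ i, 0 ≤ lam i) :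
    one0 n * Xmon n lam
      = ∑ f ∈ Finset.univ.filter
          (fun f : Fin (numCols n lam) → Finset (Fin n) =>
            (∀ j : Fin (numCols n lam), (f j).card = shapeColLen n lam (j : ℕ)) ∧
            isSSYT n (List.ofFn f)),
          Xmon n (wtVec n (List.ofFn f)) * Psi n (List.ofFn f) := by
  have h := mainG n (numCols n lam) (fun j => shapeColLen n lam (j : ℕ))
    (by
      intro a b hab
      apply Finset.card_le_card
      intro x hx
      simp only [Finset.mem_filter, Finset.mem_univ, true_and] at hx ⊢
      have : (a : ℕ) ≤ b := hab
      omega)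
    (fun j => col_card_le n _)
  rw [← lam_eq n lam hdom hnonneg] at h
  rw [h, Finset.sum_filter]

end HLHecke
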